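/- arXiv:1405.7260 — 13 statements merged into one kernel-verified Lean document; each statement's English description precedes it below -/
import Mathlib

section
/- Let K be a division ring and V a K-vector space of finite dimension n. Then every subsemilattice of the monoid End(V) of K-linear endomorphisms of V (under composition) has at most 2^n elements, and there exists a subsemilattice of End(V) with exactly 2^n elements. -/
open Module

section Compression

variable {K V : Type*} [DivisionRing K] [AddCommGroup V] [Module K V]

/-- The compression of an endomorphism `f` to the range of an endomorphism `e`. -/
def Module.End.compressRange (e f : End K V) : End K (LinearMap.range e) :=
  e.rangeRestrict ∘ₗ f ∘ₗ (LinearMap.range e).subtype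

theorem Module.End.coe_compressRange {e f : End K V} (he : e * e = e) (hf : e * f = f * e)
    (v : LinearMap.range e) : (e.compressRange f v : V) = f v := by
  obtain ⟨_, w, rfl⟩ := v
  change (e * f) (e w) = f (e w)
  rw [hf]
  change f ((e * e) w) = _
  rw [he]

theorem Module.End.compressRange_mul {e f g : End K V} (he : e * e = e) (hf : e * f = f * e)
    (hg : e * g = g * e) : e.compressRange (f * g) = e.compressRange f * e.compressRange g := by
  have hfg : e * (f * g) = f * g * e := by rw [← mul_assoc, hf, mul_assoc, hg, mul_assoc]
  ext v
  rw [coe_compressRange he hfg, Module.End.mul_apply, Module.End.mul_apply,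
    coe_compressRange he hf, coe_compressRange he hg]

theorem Module.End.eq_of_compressRange_eq {e f g : End K V} (he : e * e = e) (hf : e * f = f * e)
    (hg : e * g = g * e) (h₁ : e.compressRange f = e.compressRange g)
    (h₂ : (1 - e).compressRange f = (1 - e).compressRange g) : f = g := by
  have he' : (1 - e) * (1 - e) = 1 - e := IsIdempotentElem.one_sub he
  have hf' : (1 - e) * f = f * (1 - e) := by rw [sub_mul, mul_sub, hf, one_mul, mul_one]
  have hg' : (1 - e) * g = g * (1 - e) := by rw [sub_mul, mul_sub, hg, one_mul, mul_one]
  ext v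
  have key₁ : f (e v) = g (e v) := by
    rw [← coe_compressRange he hf ⟨e v, v, rfl⟩, h₁, coe_compressRange he hg]
  have key₂ : f ((1 - e) v) = g ((1 - e) v) := by
    rw [← coe_compressRange he' hf' ⟨(1 - e) v, v, rfl⟩, h₂, coe_compressRange he' hg']
  have hv : v = e v + (1 - e) v := by simp
  rw [hv, map_add, map_add, key₁, key₂]

theorem Module.End.finrank_range_add_finrank_range_one_sub [FiniteDimensional K V]
    {e : End K V} (he : e * e = e) :
    finrank K (LinearMap.range e) + finrank K (LinearMap.range (1 - e)) = finrank K V := by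
  have hker : LinearMap.range (1 - e) = LinearMap.ker e := by
    ext v
    constructor
    · rintro ⟨w, rfl⟩
      change (e * (1 - e)) w = 0
      rw [mul_sub, he, mul_one, sub_self, LinearMap.zero_apply]
    · intro hv
      exact ⟨v, by simp [LinearMap.mem_ker.mp hv]⟩
  rw [hker, LinearMap.finrank_range_add_finrank_ker]

theorem Module.End.finrank_range_pos [FiniteDimensional K V] {e : End K V} (he : e ≠ 0) :
    0 < finrank K (LinearMap.range e) := by
  rw [Nat.pos_iff_ne_zero, Ne, Submodule.finrank_eq_zero, LinearMap.range_eq_bot]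
  exact he

end Compression

/-- A set of pairwise commuting idempotent endomorphisms of a space of dimension `n` has at most
`2 ^ n` elements. -/
theorem Module.End.encard_le_of_commuting_idempotents {K : Type*} [DivisionRing K] (n : ℕ) :
    ∀ (V : Type*) [AddCommGroup V] [Module K V] [FiniteDimensional K V], finrank K V = n →
      ∀ E : Set (End K V), (∀ a ∈ E, a * a = a) → (∀ a ∈ E, ∀ b ∈ E, a * b = b * a) →
        E.encard ≤ 2 ^ n := by
  induction n using Nat.strong_induction_on with
  | _ n ih =>
  intro V _ _ _ hn E hid hcomm
  by_cases htriv : ∀ e ∈ E, e = 0 ∨ e = 1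
  · rcases Nat.eq_zero_or_pos n with rfl | hpos
    · have := finrank_zero_iff.mp hn
      rw [pow_zero, Set.encard_le_one_iff]
      exact fun a b _ _ => Subsingleton.elim a b
    · calc E.encard ≤ ({0, 1} : Set (End K V)).encard := Set.encard_le_encard htriv
        _ ≤ 2 := by
          rw [← one_add_one_eq_two, ← Set.encard_singleton (1 : End K V)]
          simpa only [Set.encard_singleton] using Set.encard_insert_le {(1 : End K V)} 0
        _ = 2 ^ 1 := (pow_one 2).symm
        _ ≤ 2 ^ n := pow_le_pow_right₀ (by norm_num) hpos
  · push Not at htriv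
    obtain ⟨e, heE, he0, he1⟩ := htriv
    have he := hid e heE
    have he' : (1 - e) * (1 - e) = 1 - e := IsIdempotentElem.one_sub he
    have hc : ∀ f ∈ E, e * f = f * e := hcomm e heE
    have hc' : ∀ f ∈ E, (1 - e) * f = f * (1 - e) := fun f hf => by
      rw [sub_mul, mul_sub, hc f hf, one_mul, mul_one]
    have hsum := finrank_range_add_finrank_range_one_sub he
    have hpos := finrank_range_pos he0
    have hpos' := finrank_range_pos (sub_ne_zero.mpr he1.symm)
    have bound : ∀ p : End K V, p * p = p → (∀ f ∈ E, p * f = f * p) →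
        finrank K (LinearMap.range p) < n →
        (p.compressRange '' E).encard ≤ 2 ^ finrank K (LinearMap.range p) := by
      intro p hp hpc hlt
      refine ih _ hlt _ rfl _ ?_ ?_
      · rintro _ ⟨f, hf, rfl⟩
        rw [← compressRange_mul hp (hpc f hf) (hpc f hf), hid f hf]
      · rintro _ ⟨f, hf, rfl⟩ _ ⟨g, hg, rfl⟩
        rw [← compressRange_mul hp (hpc f hf) (hpc g hg), hcomm f hf g hg,
          compressRange_mul hp (hpc g hg) (hpc f hf)]
    have hinj : Set.InjOn (fun f => (e.compressRange f, (1 - e).compressRange f)) E := by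
      intro f hf g hg hfg
      exact eq_of_compressRange_eq he (hc f hf) (hc g hg) (congrArg Prod.fst hfg)
        (congrArg Prod.snd hfg)
    calc E.encard
        = ((fun f => (e.compressRange f, (1 - e).compressRange f)) '' E).encard :=
          hinj.encard_image.symm
      _ ≤ ((e.compressRange '' E) ×ˢ ((1 - e).compressRange '' E)).encard := by
          refine Set.encard_le_encard ?_
          rintro _ ⟨f, hf, rfl⟩
          exact ⟨⟨f, hf, rfl⟩, ⟨f, hf, rfl⟩⟩
      _ = (e.compressRange '' E).encard * ((1 - e).compressRange '' E).encard :=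
          Set.encard_prod
      _ ≤ 2 ^ finrank K (LinearMap.range e) * 2 ^ finrank K (LinearMap.range (1 - e)) :=
          mul_le_mul' (bound e he hc (by omega)) (bound (1 - e) he' hc' (by omega))
      _ = 2 ^ n := by rw [← pow_add, hsum, hn]

section CoordinateProjection

variable {K V ι : Type*} [DivisionRing K] [AddCommGroup V] [Module K V] [DecidableEq ι]

/-- The projection onto the span of the basis vectors indexed by `s`, along the others. -/
noncomputable def Module.Basis.coordProj (b : Basis ι K V) (s : Finset ι) : End K V :=
  b.constr ℕ fun i => if i ∈ s then b i else 0

theorem Module.Basis.coordProj_apply (b : Basis ι K V) (s : Finset ι) (i : ι) :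
    b.coordProj s (b i) = if i ∈ s then b i else 0 :=
  b.constr_basis ℕ _ i

theorem Module.Basis.coordProj_mul (b : Basis ι K V) (s t : Finset ι) :
    b.coordProj s * b.coordProj t = b.coordProj (s ∩ t) := by
  refine b.ext fun i => ?_
  rw [Module.End.mul_apply, coordProj_apply, coordProj_apply]
  by_cases hs : i ∈ s <;> by_cases ht : i ∈ t <;> simp [hs, ht, coordProj_apply]

theorem Module.Basis.coordProj_injective (b : Basis ι K V) :
    Function.Injective b.coordProj := by
  intro s t h
  ext i
  have hi := LinearMap.congr_fun h (b i)
  rw [coordProj_apply, coordProj_apply] at hi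
  have hb := b.ne_zero i
  by_cases hs : i ∈ s <;> by_cases ht : i ∈ t <;> simp_all

end CoordinateProjection

/-- Let K be a division ring and V a K-vector space of finite dimension n.
Then every subsemilattice of the monoid End(V) of K-linear endomorphisms of V (under
composition) has at most 2^n elements, and there exists a subsemilattice of End(V) with
exactly 2^n elements. -/
theorem stmt_0 (K : Type*) [DivisionRing K] (V : Type*) [AddCommGroup V] [Module K V]
    [FiniteDimensional K V] (n : ℕ) (hn : Module.finrank K V = n) :
    (∀ E : Set (Module.End K V),
        (∀ a ∈ E, ∀ b ∈ E, a * b ∈ E) →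
        (∀ a ∈ E, a * a = a) →
        (∀ a ∈ E, ∀ b ∈ E, a * b = b * a) →
        E.Finite ∧ Nat.card E ≤ 2 ^ n) ∧
    (∃ E : Set (Module.End K V),
        (∀ a ∈ E, ∀ b ∈ E, a * b ∈ E) ∧
        (∀ a ∈ E, a * a = a) ∧
        (∀ a ∈ E, ∀ b ∈ E, a * b = b * a) ∧
        E.Finite ∧ Nat.card E = 2 ^ n) := by
  refine ⟨fun E _ hid hcomm => ?_, ?_⟩
  · have h := Module.End.encard_le_of_commuting_idempotents n V hn E hid hcomm
    have h' : E.encard ≤ ((2 ^ n : ℕ) : ℕ∞) := by exact_mod_cast h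
    obtain ⟨hfin, -⟩ := Set.encard_le_coe_iff.mp h'
    refine ⟨hfin, ?_⟩
    rw [← hfin.cast_ncard_eq] at h'
    exact_mod_cast h'
  · let b := Module.finBasisOfFinrankEq K V hn
    refine ⟨Set.range b.coordProj, ?_, ?_, ?_, Set.finite_range _, ?_⟩
    · rintro _ ⟨s, rfl⟩ _ ⟨t, rfl⟩
      exact ⟨s ∩ t, (b.coordProj_mul s t).symm⟩
    · rintro _ ⟨s, rfl⟩
      rw [b.coordProj_mul, Finset.inter_self]
    · rintro _ ⟨s, rfl⟩ _ ⟨t, rfl⟩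
      rw [b.coordProj_mul, b.coordProj_mul, Finset.inter_comm]
    · rw [Nat.card_range_of_injective b.coordProj_injective, Nat.card_eq_fintype_card,
        Fintype.card_finset, Fintype.card_fin]
end

section
/- Let X be a nonempty finite set with n elements. Then every subsemilattice of the monoid T(X) of all functions X → X (under composition) has at most 2^(n-1) elements, and there exists a subsemilattice of T(X) with exactly 2^(n-1) elements. -/
open Function

/-- Commuting idempotent self-maps with the same fixed points are equal. -/
theorem eq_of_fixedPoints_eq {X : Type*} {f g : X → X} (hf : f ∘ f = f) (hg : g ∘ g = g)
    (hfg : f ∘ g = g ∘ f) (h : fixedPoints f = fixedPoints g) : f = g := by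
  have h₁ (x : X) : f (g x) = g x := by
    have : g x ∈ fixedPoints g := congrFun hg x
    rwa [← h] at this
  have h₂ (x : X) : g (f x) = f x := by
    have : f x ∈ fixedPoints f := congrFun hf x
    rwa [h] at this
  funext x
  rw [← h₁ x, ← h₂ x]
  exact (congrFun hfg x).symm

/-- A nonempty subsemilattice of self-maps of a nonempty finite type has a common fixed point. -/
theorem exists_common_fixedPoint {X : Type*} [Finite X] [Nonempty X] {E : Set (X → X)}
    (hE : E.Nonempty) (hmul : ∀ f ∈ E, ∀ g ∈ E, f ∘ g ∈ E) (hid : ∀ f ∈ E, f ∘ f = f)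
    (hcomm : ∀ f ∈ E, ∀ g ∈ E, f ∘ g = g ∘ f) : ∃ x, ∀ f ∈ E, f x = x := by
  obtain ⟨f, hf, hmin⟩ := Set.exists_min_image E (fun f => (fixedPoints f).ncard)
    (Set.toFinite E) hE
  obtain ⟨y⟩ := ‹Nonempty X›
  refine ⟨f y, fun g hg => ?_⟩
  have hsub : fixedPoints (g ∘ f) ⊆ fixedPoints f := by
    intro x hx
    have hx : g (f x) = x := hx
    have hc : f (g (f x)) = g (f (f x)) := congrFun (hcomm f hf g hg) (f x)
    have hi : f (f x) = f x := congrFun (hid f hf) x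
    change f x = x
    rwa [hi, hx] at hc
  have heq := Set.eq_of_subset_of_ncard_le hsub (hmin _ (hmul g hg f hf)) (Set.toFinite _)
  have hmem : f y ∈ fixedPoints f := congrFun (hid f hf) y
  have hi : f (f y) = f y := hmem
  rw [← heq] at hmem
  have h : g (f (f y)) = f y := hmem
  rwa [hi] at h

/-- The number of subsets of the complement of a point. -/
theorem natCard_set_ne {X : Type*} [Fintype X] (x₀ : X) :
    Nat.card (Set {x : X // x ≠ x₀}) = 2 ^ (Fintype.card X - 1) := by
  classical
  rw [Nat.card_eq_fintype_card, Fintype.card_set, Fintype.card_subtype_compl,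
    Fintype.card_subtype_eq]

open Classical in
/-- The map fixing the points of `S` and sending every other point to `x₀`. -/
noncomputable def collapse {X : Type*} (x₀ : X) (S : Set {x : X // x ≠ x₀}) (x : X) : X :=
  if x ∈ Subtype.val '' S then x else x₀

theorem collapse_comp {X : Type*} (x₀ : X) (S T : Set {x : X // x ≠ x₀}) :
    collapse x₀ S ∘ collapse x₀ T = collapse x₀ (S ∩ T) := by
  funext x
  by_cases hx : x = x₀
  · simp [collapse, hx]
  · by_cases hS : (⟨x, hx⟩ : {x : X // x ≠ x₀}) ∈ S <;>
      by_cases hT : (⟨x, hx⟩ : {x : X // x ≠ x₀}) ∈ T <;> simp [collapse, hx, hS, hT]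

theorem collapse_injective {X : Type*} (x₀ : X) : Injective (collapse x₀) := by
  intro S T h
  ext ⟨x, hx⟩
  have h := congrFun h x
  by_cases hS : (⟨x, hx⟩ : {x : X // x ≠ x₀}) ∈ S <;>
    by_cases hT : (⟨x, hx⟩ : {x : X // x ≠ x₀}) ∈ T <;>
    simp_all [collapse, Ne.symm hx]

/-- Let X be a nonempty finite set with n elements. Then every subsemilattice
of the monoid T(X) of all functions X → X (under composition) has at most 2^(n-1) elements,
and there exists a subsemilattice of T(X) with exactly 2^(n-1) elements. -/
theorem stmt_1 (X : Type*) [Fintype X] [Nonempty X] (n : ℕ) (hn : Fintype.card X = n) :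
    (∀ E : Set (X → X),
        (∀ f ∈ E, ∀ g ∈ E, f ∘ g ∈ E) →
        (∀ f ∈ E, f ∘ f = f) →
        (∀ f ∈ E, ∀ g ∈ E, f ∘ g = g ∘ f) →
        E.Finite ∧ Nat.card E ≤ 2 ^ (n - 1)) ∧
    (∃ E : Set (X → X),
        (∀ f ∈ E, ∀ g ∈ E, f ∘ g ∈ E) ∧
        (∀ f ∈ E, f ∘ f = f) ∧
        (∀ f ∈ E, ∀ g ∈ E, f ∘ g = g ∘ f) ∧
        E.Finite ∧ Nat.card E = 2 ^ (n - 1)) := by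
  subst hn
  constructor
  · intro E hmul hid hcomm
    refine ⟨Set.toFinite E, ?_⟩
    rcases E.eq_empty_or_nonempty with rfl | hE
    · simp
    obtain ⟨x₀, hx₀⟩ := exists_common_fixedPoint hE hmul hid hcomm
    rw [← natCard_set_ne x₀]
    refine Nat.card_le_card_of_injective
      (fun f : E => {x : {x : X // x ≠ x₀} | f.1 x.1 = x.1}) ?_
    rintro ⟨f, hf⟩ ⟨g, hg⟩ h
    refine Subtype.ext (eq_of_fixedPoints_eq (hid f hf) (hid g hg) (hcomm f hf g hg) ?_)
    ext x
    by_cases hx : x = x₀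
    · subst hx
      exact iff_of_true (hx₀ f hf) (hx₀ g hg)
    · exact Set.ext_iff.mp h ⟨x, hx⟩
  · obtain ⟨x₀⟩ := ‹Nonempty X›
    refine ⟨Set.range (collapse x₀), ?_, ?_, ?_, Set.toFinite _, ?_⟩
    · rintro _ ⟨S, rfl⟩ _ ⟨T, rfl⟩
      exact ⟨S ∩ T, (collapse_comp x₀ S T).symm⟩
    · rintro _ ⟨S, rfl⟩
      rw [collapse_comp, Set.inter_self]
    · rintro _ ⟨S, rfl⟩ _ ⟨T, rfl⟩
      rw [collapse_comp, collapse_comp, Set.inter_comm]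
    · rw [← natCard_set_ne x₀]
      exact Nat.card_range_of_injective (collapse_injective x₀)
end

section
/- Let X be a nonempty finite set with n elements. Then every subsemilattice of the monoid P(X) of all partial transformations of X (partial functions from X to X under composition) has at most 2^n elements, and there exists a subsemilattice of P(X) with exactly 2^n elements. -/
namespace PFun

variable {X : Type*}

/-- The set of points fixed by a partial transformation. -/
def fixedPts (f : X →. X) : Set X := {x | x ∈ f x}

theorem comp_eq_right_of_fixedPts_subset {f g : X →. X} (hf : f.comp f = f)
    (h : f.fixedPts ⊆ g.fixedPts) : g.comp f = f := by
  have key : ∀ x y, y ∈ f x → y ∈ g y := by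
    intro x y hy
    have hy' : y ∈ f.comp f x := by rwa [hf]
    obtain ⟨z, hz, hzy⟩ := Part.mem_bind_iff.1 hy'
    obtain rfl := Part.mem_unique hy hz
    exact h hzy
  refine PFun.ext fun x y => ⟨fun hy => ?_, fun hy => ?_⟩
  · obtain ⟨z, hz, hzy⟩ := Part.mem_bind_iff.1 hy
    rwa [Part.mem_unique hzy (key x z hz)]
  · exact Part.mem_bind_iff.2 ⟨y, hy, key x y hy⟩

theorem injOn_fixedPts {E : Set (X →. X)} (hidem : ∀ f ∈ E, f.comp f = f)
    (hcomm : ∀ f ∈ E, ∀ g ∈ E, f.comp g = g.comp f) : Set.InjOn fixedPts E := by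
  intro f hf g hg h
  rw [← comp_eq_right_of_fixedPts_subset (hidem f hf) h.subset, ← hcomm f hf g hg,
    comp_eq_right_of_fixedPts_subset (hidem g hg) h.symm.subset]

/-- The identity map restricted to a set. -/
def partialId (s : Set X) : X →. X := fun x => ⟨x ∈ s, fun _ => x⟩

theorem mem_partialId {s : Set X} {x y : X} : y ∈ partialId s x ↔ x ∈ s ∧ x = y := by
  simp [partialId, Part.mem_mk_iff]

theorem partialId_injective : Function.Injective (partialId (X := X)) := by
  intro s t h
  ext x
  have hx : x ∈ partialId s x ↔ x ∈ partialId t x := by rw [h]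
  simpa [mem_partialId] using hx

theorem partialId_comp (s t : Set X) :
    (partialId s).comp (partialId t) = partialId (s ∩ t) := by
  refine PFun.ext fun x y => Part.mem_bind_iff.trans ?_
  simp only [mem_partialId, Set.mem_inter_iff]
  grind

end PFun

/-- Let X be a nonempty finite set with n elements. Then every subsemilattice
of the monoid P(X) of all partial transformations of X (partial functions from X to X under
composition) has at most 2^n elements, and there exists a subsemilattice of P(X) with
exactly 2^n elements. -/
theorem stmt_2 (X : Type*) [Fintype X] [Nonempty X] (n : ℕ) (hn : Fintype.card X = n) :
    (∀ E : Set (X →. X),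
        (∀ f ∈ E, ∀ g ∈ E, f.comp g ∈ E) →
        (∀ f ∈ E, f.comp f = f) →
        (∀ f ∈ E, ∀ g ∈ E, f.comp g = g.comp f) →
        E.Finite ∧ Nat.card E ≤ 2 ^ n) ∧
    (∃ E : Set (X →. X),
        (∀ f ∈ E, ∀ g ∈ E, f.comp g ∈ E) ∧
        (∀ f ∈ E, f.comp f = f) ∧
        (∀ f ∈ E, ∀ g ∈ E, f.comp g = g.comp f) ∧
        E.Finite ∧ Nat.card E = 2 ^ n) := by
  have hcard : Nat.card (Set X) = 2 ^ n := by
    rw [Nat.card_eq_fintype_card, Fintype.card_set, hn]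
  constructor
  · intro E _ hidem hcomm
    have hinj := PFun.injOn_fixedPts hidem hcomm
    exact ⟨Set.Finite.of_injOn (Set.mapsTo_univ _ _) hinj Set.finite_univ,
      hcard ▸ Nat.card_le_card_of_injective _ hinj.injective⟩
  · refine ⟨Set.range PFun.partialId, ?_, ?_, ?_, Set.finite_range _, ?_⟩
    · rintro _ ⟨s, rfl⟩ _ ⟨t, rfl⟩
      exact ⟨s ∩ t, (PFun.partialId_comp s t).symm⟩
    · rintro _ ⟨s, rfl⟩
      rw [PFun.partialId_comp, Set.inter_self]
    · rintro _ ⟨s, rfl⟩ _ ⟨t, rfl⟩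
      rw [PFun.partialId_comp, PFun.partialId_comp, Set.inter_comm]
    · rw [Nat.card_range_of_injective PFun.partialId_injective, hcard]
end

section
/- Let M be a monoid with at least two elements in which every non-invertible element is a left zero (if a is not a unit then a·b = a for every b ∈ M), and let S be the monoid, under composition, of all maps α : M → M satisfying α(a·b) = a·α(b) for all a, b ∈ M. If every element of M is invertible (M is a group), then every subsemilattice of S has exactly 1 element; if some element of M is not invertible, then every subsemilattice of S has at most 2 elements and there exists a subsemilattice of S with exactly 2 elements. -/
theorem eq_mul_right_of_map_mul {M : Type*} [Monoid M] {α : M → M}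
    (h : ∀ a b : M, α (a * b) = a * α b) (a : M) : α a = a * α 1 := by
  rw [← h, mul_one]

theorem eq_id_of_isUnit_map_one {M : Type*} [Monoid M] {α : M → M}
    (h : ∀ a b : M, α (a * b) = a * α b) (hid : α ∘ α = α) (hu : IsUnit (α 1)) :
    α = id := by
  have h1 : α 1 * α 1 = α 1 := by
    rw [← eq_mul_right_of_map_mul h]
    exact congrFun hid 1
  have h2 : α 1 = 1 := hu.mul_left_cancel (by rw [h1, mul_one])
  funext a
  rw [eq_mul_right_of_map_mul h, h2, mul_one, id]

theorem eq_of_comp_comm_of_ne_id {M : Type*} [Monoid M]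
    (hlz : ∀ a : M, ¬IsUnit a → ∀ b : M, a * b = a) {α β : M → M}
    (hα : ∀ a b : M, α (a * b) = a * α b) (hβ : ∀ a b : M, β (a * b) = a * β b)
    (hαα : α ∘ α = α) (hββ : β ∘ β = β) (hcomm : α ∘ β = β ∘ α)
    (hα1 : α ≠ id) (hβ1 : β ≠ id) : α = β := by
  have hu : ¬IsUnit (α 1) := fun h => hα1 (eq_id_of_isUnit_map_one hα hαα h)
  have hv : ¬IsUnit (β 1) := fun h => hβ1 (eq_id_of_isUnit_map_one hβ hββ h)
  have h1 : α (β 1) = β (α 1) := congrFun hcomm 1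
  rw [eq_mul_right_of_map_mul hα, eq_mul_right_of_map_mul hβ (α 1), hlz _ hu, hlz _ hv] at h1
  funext a
  rw [eq_mul_right_of_map_mul hα, eq_mul_right_of_map_mul hβ, h1]


/-- Let M be a monoid with at least two elements in which every non-invertible
element is a left zero, and let S be the monoid, under composition, of all maps α : M → M
satisfying α(a·b) = a·α(b) for all a, b ∈ M. If M is a group, then every (nonempty)
subsemilattice of S has exactly 1 element; if some element of M is not invertible, then
every subsemilattice of S has at most 2 elements and there exists a subsemilattice of S
with exactly 2 elements. -/
theorem stmt_3 (M : Type*) [Monoid M] (hM : ∃ a b : M, a ≠ b)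
    (hlz : ∀ a : M, ¬IsUnit a → ∀ b : M, a * b = a) :
    ((∀ a : M, IsUnit a) →
      ∀ E : Set (M → M),
        (∀ α ∈ E, ∀ a b : M, α (a * b) = a * α b) →
        (∀ α ∈ E, ∀ β ∈ E, α ∘ β ∈ E) →
        (∀ α ∈ E, α ∘ α = α) →
        (∀ α ∈ E, ∀ β ∈ E, α ∘ β = β ∘ α) →
        E.Nonempty → Nat.card E = 1) ∧
    ((∃ a : M, ¬IsUnit a) →
      (∀ E : Set (M → M),
        (∀ α ∈ E, ∀ a b : M, α (a * b) = a * α b) →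
        (∀ α ∈ E, ∀ β ∈ E, α ∘ β ∈ E) →
        (∀ α ∈ E, α ∘ α = α) →
        (∀ α ∈ E, ∀ β ∈ E, α ∘ β = β ∘ α) →
        E.Finite ∧ Nat.card E ≤ 2) ∧
      (∃ E : Set (M → M),
        (∀ α ∈ E, ∀ a b : M, α (a * b) = a * α b) ∧
        (∀ α ∈ E, ∀ β ∈ E, α ∘ β ∈ E) ∧
        (∀ α ∈ E, α ∘ α = α) ∧
        (∀ α ∈ E, ∀ β ∈ E, α ∘ β = β ∘ α) ∧
        E.Finite ∧ Nat.card E = 2)) := by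
  refine ⟨fun hG E hS _ hid _ hne => ?_, fun ⟨a, ha⟩ => ⟨fun E hS _ hid hcomm => ?_, ?_⟩⟩
  · have hE : E = {id} := hne.subset_singleton_iff.mp fun α hα =>
      eq_id_of_isUnit_map_one (hS α hα) (hid α hα) (hG _)
    rw [hE, Nat.card_coe_set_eq, Set.ncard_singleton]
  · obtain ⟨γ, hγ⟩ : ∃ γ : M → M, E ⊆ {id, γ} := by
      by_cases h : ∃ γ ∈ E, γ ≠ id
      · obtain ⟨γ, hγ, hne⟩ := h
        refine ⟨γ, fun α hα => or_iff_not_imp_left.mpr fun hα1 => ?_⟩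
        exact eq_of_comp_comm_of_ne_id hlz (hS α hα) (hS γ hγ) (hid α hα) (hid γ hγ)
          (hcomm α hα γ hγ) hα1 hne
      · push Not at h
        exact ⟨id, fun α hα => Or.inl (h α hα)⟩
    have hfin : ({id, γ} : Set (M → M)).Finite := Set.toFinite _
    refine ⟨hfin.subset hγ, ?_⟩
    rw [Nat.card_coe_set_eq]
    exact (Set.ncard_le_ncard hγ hfin).trans ((Set.ncard_insert_le _ _).trans_eq (by rw [Set.ncard_singleton]))
  · have haa : (fun x : M => x * a) ∘ (fun x => x * a) = fun x => x * a := by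
      funext x
      simp only [Function.comp_apply, mul_assoc, hlz a ha]
    have hne : (id : M → M) ≠ fun x => x * a := fun h => ha <| by
      have h1 : (1 : M) = 1 * a := congrFun h 1
      rw [one_mul] at h1
      exact h1 ▸ isUnit_one
    refine ⟨{id, fun x => x * a}, ?_, ?_, ?_, ?_, Set.toFinite _, ?_⟩
    · rintro α (rfl | rfl) x y
      · rfl
      · exact mul_assoc x y a
    · rintro α (rfl | rfl) β (rfl | rfl)
      · exact Or.inl rfl
      · exact Or.inr rfl
      · exact Or.inr rfl
      · exact Or.inr haa
    · rintro α (rfl | rfl)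
      · rfl
      · exact haa
    · rintro α (rfl | rfl) β (rfl | rfl) <;> rfl
    · rw [Nat.card_coe_set_eq, Set.ncard_pair hne]
end

section
/- Let M be a monoid with at least two elements in which every non-invertible element is a left zero (if a is not a unit then a·b = a for every b ∈ M). Let ε₁, ε₂ : M → M be maps satisfying εᵢ(a·b) = a·εᵢ(b) for all a, b ∈ M, such that ε₁ and ε₂ are idempotent under composition (εᵢ ∘ εᵢ = εᵢ), commute (ε₁ ∘ ε₂ = ε₂ ∘ ε₁), and are both different from the identity map. Then ε₁ = ε₂. -/
/-- Let M be a monoid with at least two elements in which every non-invertible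
element is a left zero. Let ε₁, ε₂ : M → M satisfy εᵢ(a·b) = a·εᵢ(b) for all a, b ∈ M, be
idempotent under composition, commute, and both be different from the identity map.
Then ε₁ = ε₂. -/
theorem stmt_4 (M : Type*) [Monoid M] (hM : ∃ a b : M, a ≠ b)
    (hlz : ∀ a : M, ¬IsUnit a → ∀ b : M, a * b = a)
    (ε₁ ε₂ : M → M)
    (h₁ : ∀ a b : M, ε₁ (a * b) = a * ε₁ b)
    (h₂ : ∀ a b : M, ε₂ (a * b) = a * ε₂ b)
    (hi₁ : ε₁ ∘ ε₁ = ε₁) (hi₂ : ε₂ ∘ ε₂ = ε₂)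
    (hc : ε₁ ∘ ε₂ = ε₂ ∘ ε₁)
    (hn₁ : ε₁ ≠ id) (hn₂ : ε₂ ≠ id) :
    ε₁ = ε₂ := by
  have key : ∀ ε : M → M, (∀ a b : M, ε (a * b) = a * ε b) → ε ∘ ε = ε → ε ≠ id →
      (∀ a, ε a = a * ε 1) ∧ ¬IsUnit (ε 1) := by
    intro ε h hi hn
    have hmul : ∀ a, ε a = a * ε 1 := fun a => by simpa using h a 1
    refine ⟨hmul, fun hu => hn (funext fun a => ?_)⟩
    have hidem : ε 1 * ε 1 = ε 1 * 1 := by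
      rw [← hmul, mul_one]
      exact congrFun hi 1
    rw [hmul, hu.mul_left_cancel hidem, mul_one, id]
  obtain ⟨hm₁, hu₁⟩ := key ε₁ h₁ hi₁ hn₁
  obtain ⟨hm₂, hu₂⟩ := key ε₂ h₂ hi₂ hn₂
  have hcomm : ε₁ (ε₂ 1) = ε₂ (ε₁ 1) := congrFun hc 1
  rw [hm₁ (ε₂ 1), hm₂ (ε₁ 1), hlz _ hu₂, hlz _ hu₁] at hcomm
  funext a
  rw [hm₁, hm₂, hcomm]
end

section
/- Let A be a quasifield. Then every idempotent endomorphism of the quasifield independence algebra on A other than the identity map is a constant map; consequently, every subsemilattice of the monoid of endomorphisms of the quasifield independence algebra on A (under composition) has at most 2 elements, and there exists such a subsemilattice with exactly 2 elements. -/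
/-- A quasifield: a set `A` with a multiplication, a subtraction and a zero such that
`a·0 = 0·a = 0`, `A∖{0}` is a group under multiplication (with identity `one` and
inversion `inv`), and the axioms (i) `a−0 = a`, (ii) `a(b−c) = ab−ac`,
(iii) `a−(a−c) = c`, (iv) `a−(b−c) = (a−b)−(a−b)(b−a)⁻¹c` for `a ≠ b` hold. -/
class Quasifield (A : Type*) where
  mul : A → A → A
  sub : A → A → A
  zero : A
  one : A
  inv : A → A
  zero_mul : ∀ a, mul zero a = zero
  mul_zero : ∀ a, mul a zero = zero
  mul_assoc : ∀ a b c, a ≠ zero → b ≠ zero → c ≠ zero →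
    mul (mul a b) c = mul a (mul b c)
  mul_ne_zero : ∀ a b, a ≠ zero → b ≠ zero → mul a b ≠ zero
  one_ne_zero : one ≠ zero
  one_mul : ∀ a, a ≠ zero → mul one a = a
  mul_one : ∀ a, a ≠ zero → mul a one = a
  inv_ne_zero : ∀ a, a ≠ zero → inv a ≠ zero
  mul_inv : ∀ a, a ≠ zero → mul a (inv a) = one
  inv_mul : ∀ a, a ≠ zero → mul (inv a) a = one
  sub_zero : ∀ a, sub a zero = a
  mul_sub : ∀ a b c, mul a (sub b c) = sub (mul a b) (mul a c)
  sub_sub_cancel : ∀ a c, sub a (sub a c) = c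
  sub_sub : ∀ a b c, a ≠ b →
    sub a (sub b c) = sub (sub a b) (mul (mul (sub a b) (inv (sub b a))) c)

/-- A `k`-ary operation `f` of the quasifield independence algebra on `A`:
`f(a − b·x₁, …, a − b·x_k) = a − b·f(x₁, …, x_k)` for all `a, b, x₁, …, x_k`. -/
def IsQuasiOp {A : Type*} [Quasifield A] {k : ℕ} (f : (Fin k → A) → A) : Prop :=
  ∀ a b : A, ∀ x : Fin k → A,
    f (fun i => Quasifield.sub a (Quasifield.mul b (x i))) =
      Quasifield.sub a (Quasifield.mul b (f x))

/-- An endomorphism of the quasifield independence algebra on `A`: a map preserving every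
`k`-ary operation (`k ≥ 1`) satisfying the quasifield-operation identity. -/
def IsQEndo {A : Type*} [Quasifield A] (α : A → A) : Prop :=
  ∀ k : ℕ, 1 ≤ k → ∀ f : (Fin k → A) → A, IsQuasiOp f →
    ∀ x : Fin k → A, α (f x) = f (α ∘ x)

namespace Quasifield

variable {A : Type*} [Quasifield A]

theorem mul_assoc_all (a b c : A) : mul (mul a b) c = mul a (mul b c) := by
  by_cases ha : a = zero
  · simp only [ha, zero_mul]
  by_cases hb : b = zero
  · simp only [hb, zero_mul, mul_zero]
  by_cases hc : c = zero
  · simp only [hc, mul_zero]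
  exact mul_assoc a b c ha hb hc

theorem one_mul_all (a : A) : mul one a = a := by
  by_cases ha : a = zero
  · rw [ha, mul_zero]
  · exact one_mul a ha

theorem mul_one_all (a : A) : mul a one = a := by
  by_cases ha : a = zero
  · rw [ha, zero_mul]
  · exact mul_one a ha

theorem sub_self (a : A) : sub a a = zero := by
  simpa only [sub_zero] using sub_sub_cancel a zero

theorem sub_ne_zero {a b : A} (h : a ≠ b) : sub a b ≠ zero := by
  intro h0
  have h1 := sub_sub_cancel a b
  rw [h0, sub_zero] at h1
  exact h h1

theorem zero_sub (a : A) : sub zero a = mul a (sub zero one) := by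
  rw [mul_sub, mul_zero, mul_one_all]

/-- The element `0 − 1` is central. -/
theorem zero_sub_one_mul (a : A) : mul (sub zero one) a = mul a (sub zero one) := by
  by_cases ha : a = zero
  · rw [ha, mul_zero, zero_mul]
  have h := sub_sub zero a (sub a one) (Ne.symm ha)
  rw [sub_sub_cancel a one, mul_sub, sub_zero, mul_assoc_all _ _ a, inv_mul a ha, mul_one_all,
    sub_sub_cancel, mul_one_all, zero_sub a] at h
  rw [h, mul_assoc_all _ _ a, inv_mul a ha, mul_one_all, ← h]

theorem zero_sub_mul (a c : A) : mul (sub zero a) c = sub zero (mul a c) := by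
  rw [zero_sub a, zero_sub (mul a c), mul_assoc_all, zero_sub_one_mul, mul_assoc_all]

theorem sub_sub_sub {a u : A} (v : A) (h : a ≠ u) :
    sub (sub a u) (sub a v) = mul (mul (sub a u) (inv (sub u a))) (sub u v) := by
  have h1 := sub_sub a u (sub u v) h
  rw [sub_sub_cancel] at h1
  rw [h1, sub_sub_cancel]

theorem sub_sub_sub_mul (a u v c : A) :
    sub a (sub u (mul (sub u v) c)) =
      sub (sub a u) (mul (sub (sub a u) (sub a v)) c) := by
  by_cases h : a = u
  · subst h
    rw [sub_self, zero_sub_mul, sub_sub_cancel, sub_sub_cancel]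
  · rw [sub_sub _ _ _ h, sub_sub_sub v h, mul_assoc_all _ (sub u v)]

/-- The binary operation `(x, y) ↦ x − (x − y)c`. -/
theorem isQuasiOp_sub_sub_mul (c : A) :
    IsQuasiOp (fun x : Fin 2 → A => sub (x 0) (mul (sub (x 0) (x 1)) c)) := by
  intro a b x
  dsimp only
  rw [mul_sub, ← mul_assoc_all, mul_sub, sub_sub_sub_mul]

theorem exists_sub_sub_mul_eq {p q : A} (h : p ≠ q) (z : A) :
    ∃ c, sub p (mul (sub p q) c) = z := by
  refine ⟨mul (inv (sub p q)) (sub p z), ?_⟩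
  rw [← mul_assoc_all, mul_inv _ (sub_ne_zero h), one_mul_all, sub_sub_cancel]

end Quasifield

section

variable {A : Type*} [Quasifield A]

theorem IsQuasiOp.apply_const {k : ℕ} {f : (Fin k → A) → A} (hf : IsQuasiOp f) (a : A) :
    f (fun _ => a) = a := by
  simpa only [Quasifield.zero_mul, Quasifield.sub_zero] using hf a Quasifield.zero (fun _ => a)

theorem isQEndo_const (a : A) : IsQEndo (fun _ : A => a) :=
  fun _ _ _ hf _ => (hf.apply_const a).symm

theorem isQEndo_id : IsQEndo (id : A → A) :=
  fun _ _ _ _ _ => rfl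

theorem IsQEndo.map_sub_sub_mul {α : A → A} (hα : IsQEndo α) (p q c : A) :
    α (Quasifield.sub p (Quasifield.mul (Quasifield.sub p q) c)) =
      Quasifield.sub (α p) (Quasifield.mul (Quasifield.sub (α p) (α q)) c) :=
  hα 2 one_le_two _ (Quasifield.isQuasiOp_sub_sub_mul c) ![p, q]

theorem IsQEndo.eq_id_of_fixed {α : A → A} (hα : IsQEndo α) {p q : A} (h : p ≠ q)
    (hp : α p = p) (hq : α q = q) : α = id := by
  funext z
  obtain ⟨c, rfl⟩ := Quasifield.exists_sub_sub_mul_eq h z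
  rw [hα.map_sub_sub_mul, hp, hq, id]

theorem IsQEndo.exists_eq_const_of_idempotent {ε : A → A} (hε : IsQEndo ε) (h : ε ∘ ε = ε)
    (hne : ε ≠ id) : ∃ c : A, ∀ x : A, ε x = c := by
  refine ⟨ε Quasifield.zero, fun x => ?_⟩
  by_contra hx
  exact hne (hε.eq_id_of_fixed hx (congrFun h x) (congrFun h _))

end

/-- Let A be a quasifield. Then every idempotent endomorphism of the
quasifield independence algebra on A other than the identity map is a constant map;
consequently, every subsemilattice of the monoid of endomorphisms of the quasifield
independence algebra on A (under composition) has at most 2 elements, and there exists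
such a subsemilattice with exactly 2 elements. -/
theorem stmt_6 (A : Type*) [Quasifield A] :
    (∀ ε : A → A, IsQEndo ε → ε ∘ ε = ε → ε ≠ id → ∃ c : A, ∀ x : A, ε x = c) ∧
    (∀ E : Set (A → A),
        (∀ α ∈ E, IsQEndo α) →
        (∀ α ∈ E, ∀ β ∈ E, α ∘ β ∈ E) →
        (∀ α ∈ E, α ∘ α = α) →
        (∀ α ∈ E, ∀ β ∈ E, α ∘ β = β ∘ α) →
        E.Finite ∧ Nat.card E ≤ 2) ∧
    (∃ E : Set (A → A),
        (∀ α ∈ E, IsQEndo α) ∧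
        (∀ α ∈ E, ∀ β ∈ E, α ∘ β ∈ E) ∧
        (∀ α ∈ E, α ∘ α = α) ∧
        (∀ α ∈ E, ∀ β ∈ E, α ∘ β = β ∘ α) ∧
        E.Finite ∧ Nat.card E = 2) := by
  refine ⟨fun ε hε h hne => hε.exists_eq_const_of_idempotent h hne, ?_, ?_⟩
  · intro E hE _ hid hcomm
    obtain ⟨c, hc⟩ : ∃ c : A, E ⊆ {id, fun _ => c} := by
      by_cases h : ∃ α ∈ E, α ≠ id
      · obtain ⟨α, hα, hne⟩ := h
        obtain ⟨c, hc⟩ := (hE α hα).exists_eq_const_of_idempotent (hid α hα) hne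
        refine ⟨c, fun β hβ => ?_⟩
        by_cases hβne : β = id
        · exact Or.inl hβne
        obtain ⟨d, hd⟩ := (hE β hβ).exists_eq_const_of_idempotent (hid β hβ) hβne
        have hcd : c = d := by
          simpa only [Function.comp_apply, hc, hd] using congrFun (hcomm α hα β hβ) c
        exact Or.inr (funext fun x => (hd x).trans hcd.symm)
      · push Not at h
        exact ⟨Quasifield.zero, fun β hβ => Or.inl (h β hβ)⟩
    have hfin : ({id, fun _ => c} : Set (A → A)).Finite := Set.toFinite _
    refine ⟨hfin.subset hc, ?_⟩
    rw [Nat.card_coe_set_eq]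
    exact (Set.ncard_le_ncard hc hfin).trans
      ((Set.ncard_insert_le _ _).trans (by rw [Set.ncard_singleton]))
  · have hne : (id : A → A) ≠ fun _ => Quasifield.zero :=
      fun h => Quasifield.one_ne_zero (congrFun h Quasifield.one)
    refine ⟨{id, fun _ => Quasifield.zero}, ?_, ?_, ?_, ?_, Set.toFinite _, ?_⟩
    · rintro α (rfl | rfl)
      exacts [isQEndo_id, isQEndo_const _]
    · rintro α (rfl | rfl) β (rfl | rfl)
      exacts [Or.inl rfl, Or.inr rfl, Or.inr rfl, Or.inr rfl]
    · rintro α (rfl | rfl) <;> rfl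
    · rintro α (rfl | rfl) β (rfl | rfl) <;> rfl
    · rw [Nat.card_coe_set_eq, Set.ncard_pair hne]
end

section
/- Let A be a set with exactly 4 elements, i : A → A an involution without fixed points, and q : A × A × A → A a symmetric ternary operation satisfying q(x,y,i(x)) = y and q(x,y,x) = x for all x, y ∈ A. Then every subsemilattice of the monoid (under composition) of maps ε : A → A that preserve i and q (i.e., ε(i(x)) = i(ε(x)) and ε(q(x,y,z)) = q(ε(x),ε(y),ε(z)) for all x,y,z) has at most 2 elements, and there exists such a subsemilattice with exactly 2 elements. -/
/-- A ternary operation is symmetric if it is invariant under all permutations of its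
three arguments. -/
def IsSymm3 {A : Type*} (q : A → A → A → A) : Prop :=
  ∀ x y z : A, q x y z = q x z y ∧ q x y z = q y x z ∧ q x y z = q y z x ∧
    q x y z = q z x y ∧ q x y z = q z y x

section Involution

variable {A : Type*} [Fintype A] {i : A → A}

/-- In a four-element set with a fixed-point-free involution, two distinct orbits cover
everything. -/
theorem eq_or_eq_of_card_eq_four (hA : Fintype.card A = 4) (hii : ∀ x, i (i x) = x)
    (hif : ∀ x, i x ≠ x) {a b : A} (hab : b ≠ a) (hiab : b ≠ i a) (y : A) :
    y = a ∨ y = i a ∨ y = b ∨ y = i b := by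
  classical
  have hcard : ({a, i a, b, i b} : Finset A).card = 4 := by
    have h1 : a ≠ i b := fun h => hiab (by rw [h, hii])
    have h2 : i a ≠ i b := fun h => hab (by rw [← hii b, ← h, hii])
    rw [Finset.card_insert_of_notMem, Finset.card_insert_of_notMem,
      Finset.card_insert_of_notMem, Finset.card_singleton]
    · simpa using (hif b).symm
    · simpa using ⟨hiab.symm, h2⟩
    · simpa using ⟨(hif a).symm, hab.symm, h1⟩
  have huniv : ({a, i a, b, i b} : Finset A) = Finset.univ :=
    Finset.eq_univ_of_card _ (hcard.trans hA.symm)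
  have hy : y ∈ ({a, i a, b, i b} : Finset A) := huniv ▸ Finset.mem_univ y
  simpa using hy

/-- A map commuting with the involution automatically preserves `q`. -/
theorem map_ternary_of_comm (hA : Fintype.card A = 4) (hii : ∀ x, i (i x) = x)
    (hif : ∀ x, i x ≠ x) {q : A → A → A → A} (hsymm : IsSymm3 q)
    (hq1 : ∀ x y, q x y (i x) = y) (hq2 : ∀ x y, q x y x = x)
    {ε : A → A} (hε : ∀ x, ε (i x) = i (ε x)) (x y z : A) :
    ε (q x y z) = q (ε x) (ε y) (ε z) := by
  have h12 (u v : A) : q u u v = u := by rw [(hsymm u u v).1, hq2]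
  have h12' (u v : A) : q u (i u) v = v := by rw [(hsymm u (i u) v).1, hq1]
  have h23 (u v : A) : q u v v = v := by rw [(hsymm u v v).2.1, hq2]
  have h23' (u v : A) : q u v (i v) = u := by rw [(hsymm u v (i v)).2.1, hq1]
  by_cases hxy : y = x
  · simp only [hxy, h12]
  by_cases hxy' : y = i x
  · simp only [hxy', hε, h12']
  rcases eq_or_eq_of_card_eq_four hA hii hif hxy hxy' z with h | h | h | h
  · simp only [h, hq2]
  · simp only [h, hε, hq1]
  · simp only [h, h23]
  · simp only [h, hε, h23']

/-- The image of a non-identity idempotent commuting with the involution is a single orbit. -/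
theorem eq_or_eq_of_idempotent_of_ne_id (hA : Fintype.card A = 4) (hii : ∀ x, i (i x) = x)
    (hif : ∀ x, i x ≠ x) {e : A → A} (he : ∀ x, e (i x) = i (e x)) (hee : ∀ x, e (e x) = e x)
    (hne : e ≠ id) {p : A} (hp : e p = p) (y : A) : e y = p ∨ e y = i p := by
  obtain ⟨x, hx⟩ := Function.ne_iff.mp hne
  have hxp : x ≠ p := fun h => hx (by rw [h, hp, id])
  have hxp' : x ≠ i p := fun h => hx (by rw [h, he, hp, id])
  have hex : e x = p ∨ e x = i p := by
    rcases eq_or_eq_of_card_eq_four hA hii hif hxp hxp' (e x) with h | h | h | h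
    · exact .inl h
    · exact .inr h
    · exact absurd h hx
    · have h' := hee x
      rw [h, he, h, hii] at h'
      exact absurd h'.symm (hif x)
  rcases eq_or_eq_of_card_eq_four hA hii hif hxp hxp' y with h | h | h | h <;> subst h
  · exact .inl hp
  · exact .inr (by rw [he, hp])
  · exact hex
  · rw [he]
    rcases hex with h | h
    · exact .inr (by rw [h])
    · exact .inl (by rw [h, hii])

/-- Commuting non-identity idempotents that commute with the involution are equal. -/
theorem eq_of_commuting_idempotents (hA : Fintype.card A = 4) (hii : ∀ x, i (i x) = x)
    (hif : ∀ x, i x ≠ x) {e f : A → A} (he : ∀ x, e (i x) = i (e x))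
    (hf : ∀ x, f (i x) = i (f x)) (hee : ∀ x, e (e x) = e x) (hff : ∀ x, f (f x) = f x)
    (hef : ∀ x, e (f x) = f (e x)) (hne : e ≠ id) (hnf : f ≠ id) : e = f := by
  funext y
  have hep : e (e (f y)) = e (f y) := hee _
  have hfp : f (e (f y)) = e (f y) := by rw [← hef, hff]
  have h1 : f (e y) = e y := by
    rcases eq_or_eq_of_idempotent_of_ne_id hA hii hif he hee hne hep y with h | h
    · rw [h, hfp]
    · rw [h, hf, hfp]
  have h2 : e (f y) = f y := by
    rcases eq_or_eq_of_idempotent_of_ne_id hA hii hif hf hff hnf hfp y with h | h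
    · rw [h, hep]
    · rw [h, he, hep]
  rw [← h1, ← hef, h2]

/-- There is a non-identity idempotent commuting with the involution. -/
theorem exists_idempotent_ne_id (hA : Fintype.card A = 4) (hii : ∀ x, i (i x) = x)
    (hif : ∀ x, i x ≠ x) :
    ∃ e : A → A, (∀ x, e (i x) = i (e x)) ∧ (∀ x, e (e x) = e x) ∧ e ≠ id := by
  classical
  obtain ⟨a⟩ : Nonempty A := Fintype.card_pos_iff.mp (by omega)
  obtain ⟨b, hb⟩ : ∃ b, b ∉ ({a, i a} : Finset A) := by
    by_contra! h
    have h' := Finset.card_le_two (a := a) (b := i a)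
    rw [Finset.eq_univ_iff_forall.mpr h, Finset.card_univ, hA] at h'
    omega
  obtain ⟨hba, hbia⟩ : b ≠ a ∧ b ≠ i a := by simpa using hb
  refine ⟨fun y => if y = b then a else if y = i b then i a else y, fun x => ?_, fun x => ?_,
    fun h => hba ?_⟩
  · grind
  · grind
  · simpa using (congrFun h b).symm

end Involution

/-- Let A be a set with exactly 4 elements, i : A → A an involution without
fixed points, and q a symmetric ternary operation satisfying q(x,y,i(x)) = y and
q(x,y,x) = x. Then every subsemilattice of the monoid (under composition) of maps
ε : A → A that preserve i and q has at most 2 elements, and there exists such a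
subsemilattice with exactly 2 elements. -/
theorem stmt_7 (A : Type*) [Fintype A] (hA : Fintype.card A = 4)
    (i : A → A) (hii : ∀ x, i (i x) = x) (hif : ∀ x, i x ≠ x)
    (q : A → A → A → A) (hsymm : IsSymm3 q)
    (hq1 : ∀ x y, q x y (i x) = y) (hq2 : ∀ x y, q x y x = x) :
    (∀ E : Set (A → A),
        (∀ ε ∈ E, (∀ x, ε (i x) = i (ε x)) ∧
          (∀ x y z, ε (q x y z) = q (ε x) (ε y) (ε z))) →
        (∀ α ∈ E, ∀ β ∈ E, α ∘ β ∈ E) →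
        (∀ α ∈ E, α ∘ α = α) →
        (∀ α ∈ E, ∀ β ∈ E, α ∘ β = β ∘ α) →
        E.Finite ∧ Nat.card E ≤ 2) ∧
    (∃ E : Set (A → A),
        (∀ ε ∈ E, (∀ x, ε (i x) = i (ε x)) ∧
          (∀ x y z, ε (q x y z) = q (ε x) (ε y) (ε z))) ∧
        (∀ α ∈ E, ∀ β ∈ E, α ∘ β ∈ E) ∧
        (∀ α ∈ E, α ∘ α = α) ∧
        (∀ α ∈ E, ∀ β ∈ E, α ∘ β = β ∘ α) ∧
        E.Finite ∧ Nat.card E = 2) := by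
  constructor
  · intro E hE _ hidem hcomm
    obtain ⟨e, hsub⟩ : ∃ e : A → A, E ⊆ {id, e} := by
      by_cases h : ∃ e ∈ E, e ≠ id
      · obtain ⟨e, heE, hne⟩ := h
        refine ⟨e, fun f hfE => ?_⟩
        by_cases hnf : f = id
        · exact .inl hnf
        · exact .inr (eq_of_commuting_idempotents hA hii hif (hE f hfE).1 (hE e heE).1
            (congrFun (hidem f hfE)) (congrFun (hidem e heE))
            (congrFun (hcomm f hfE e heE)) hnf hne)
      · push Not at h
        exact ⟨id, fun f hf => .inl (h f hf)⟩
    have hfin : ({id, e} : Set (A → A)).Finite := Set.toFinite _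
    refine ⟨hfin.subset hsub, ?_⟩
    rw [Nat.card_coe_set_eq]
    exact (Set.ncard_le_ncard hsub hfin).trans ((Set.ncard_insert_le id {e}).trans (by simp))
  · obtain ⟨e, he, hee, hne⟩ := exists_idempotent_ne_id hA hii hif
    have hee' : e ∘ e = e := funext hee
    refine ⟨{id, e}, ?_, ?_, ?_, ?_, Set.toFinite _, ?_⟩
    · rintro ε (rfl | rfl)
      · exact ⟨fun _ => rfl, fun _ _ _ => rfl⟩
      · exact ⟨he, map_ternary_of_comm hA hii hif hsymm hq1 hq2 he⟩
    · rintro α (rfl | rfl) β (rfl | rfl) <;> simp [hee']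
    · rintro α (rfl | rfl)
      · rfl
      · exact hee'
    · rintro α (rfl | rfl) β (rfl | rfl) <;> rfl
    · rw [Nat.card_coe_set_eq, Set.ncard_pair hne.symm]
end

section
/- Let A be a set with exactly 4 elements and i : A → A an involution without fixed points. If q and q' are symmetric ternary operations on A both satisfying q(x,y,i(x)) = y and q(x,y,x) = x for all x, y ∈ A (and likewise for q'), then q = q'. -/
/-- In a four-element set with a fixed-point-free involution, among any three elements two
are equal or exchanged by the involution. -/
theorem eq_or_eq_involution_of_card_eq_four {A : Type*} [Fintype A] (hA : Fintype.card A = 4)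
    {i : A → A} (hii : ∀ x, i (i x) = x) (hif : ∀ x, i x ≠ x) (x y z : A) :
    x = y ∨ x = z ∨ y = z ∨ y = i x ∨ z = i x ∨ z = i y := by
  classical
  by_contra! h
  obtain ⟨hxy, hxz, hyz, hyx, hzx, hzy⟩ := h
  have hcard : ({x, i x, y, i y, z} : Finset A).card = 5 := by
    have := hif x
    have := hif y
    have := hii x
    have := hii y
    repeat rw [Finset.card_insert_of_notMem (by simp; grind)]
    simp
  have := Finset.card_le_univ ({x, i x, y, i y, z} : Finset A)
  omega

/-- Let A be a set with exactly 4 elements and i an involution without fixed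
points. If q and q' are symmetric ternary operations on A both satisfying q(x,y,i(x)) = y
and q(x,y,x) = x, then q = q'. -/
theorem stmt_8 (A : Type*) [Fintype A] (hA : Fintype.card A = 4)
    (i : A → A) (hii : ∀ x, i (i x) = x) (hif : ∀ x, i x ≠ x)
    (q q' : A → A → A → A) (hsymm : IsSymm3 q) (hsymm' : IsSymm3 q')
    (hq1 : ∀ x y, q x y (i x) = y) (hq2 : ∀ x y, q x y x = x)
    (hq1' : ∀ x y, q' x y (i x) = y) (hq2' : ∀ x y, q' x y x = x) :
    q = q' := by
  funext x y z
  obtain ⟨h1, h2, -⟩ := hsymm x y z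
  obtain ⟨h1', h2', -⟩ := hsymm' x y z
  rcases eq_or_eq_involution_of_card_eq_four hA hii hif x y z with
    rfl | rfl | rfl | rfl | rfl | rfl
  · rw [h1, h1', hq2, hq2']
  · rw [hq2, hq2']
  · rw [h2, h2', hq2, hq2']
  · rw [h1, h1', hq1, hq1']
  · rw [hq1, hq1']
  · rw [h2, h2', hq1, hq1']
end

section
/- Let G be a group acting freely on a nonempty set A (for every g ≠ 1 in G and every a ∈ A, g·a ≠ a), and suppose the action has exactly n orbits, with n finite and n ≥ 1. Let S be the monoid, under composition, of all G-equivariant maps α : A → A (α(g·a) = g·α(a) for all g ∈ G, a ∈ A). Then every subsemilattice of S has at most 2^(n-1) elements, and there exists a subsemilattice of S with exactly 2^(n-1) elements. -/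
/-- The sets containing a fixed element of a finite type number `2 ^ (card - 1)`. -/
lemma card_setOf_mem {Q : Type*} [Finite Q] (q₀ : Q) :
    Nat.card {P : Set Q | q₀ ∈ P} = 2 ^ (Nat.card Q - 1) := by
  classical
  have := Fintype.ofFinite Q
  let e : {P : Set Q | q₀ ∈ P} ≃ Set {q // q ≠ q₀} :=
    { toFun P := Subtype.val ⁻¹' P.1
      invFun T := ⟨insert q₀ (Subtype.val '' T), Set.mem_insert _ _⟩
      left_inv := by
        rintro ⟨P, hP⟩
        ext q
        by_cases h : q = q₀
        · subst h
          simpa using hP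
        · simp [h]
      right_inv T := by
        ext ⟨q, hq⟩
        simp [hq] }
  rw [Nat.card_congr e, Nat.card_eq_fintype_card, Fintype.card_set, Nat.card_eq_fintype_card]
  congr 1
  exact Set.card_ne_eq q₀

/-- Commuting idempotent maps with the same fixed points are equal. -/
lemma eq_of_commuting_idempotents_s11 {A : Type*} {α β : A → A} (hα : α ∘ α = α) (hβ : β ∘ β = β)
    (hαβ : α ∘ β = β ∘ α) (h : ∀ a, α a = a ↔ β a = a) : α = β := by
  funext x
  calc α x = β (α x) := ((h _).1 (congrFun hα x)).symm
    _ = α (β x) := (congrFun hαβ x).symm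
    _ = β x := (h _).2 (congrFun hβ x)

section EquivariantSemilattice

variable {G A Q : Type*} [Group G] [MulAction G A] {π : A → Q}

/-- A semilattice of equivariant maps has at most `2 ^ (n - 1)` elements, where `n` is the number
of orbits and `π` is the orbit map. -/
lemma card_le_of_equivariant_semilattice [Finite Q] [Nonempty A]
    (hπ : ∀ a b, π a = π b → ∃ g : G, g • a = b) {E : Set (A → A)}
    (heq : ∀ α ∈ E, ∀ g : G, ∀ a : A, α (g • a) = g • α a)
    (hmul : ∀ α ∈ E, ∀ β ∈ E, α ∘ β ∈ E)
    (hid : ∀ α ∈ E, α ∘ α = α)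
    (hcomm : ∀ α ∈ E, ∀ β ∈ E, α ∘ β = β ∘ α) :
    E.Finite ∧ Nat.card E ≤ 2 ^ (Nat.card Q - 1) := by
  let F (α : A → A) : Set Q := π '' {a | α a = a}
  have mem_F : ∀ α ∈ E, ∀ a, π a ∈ F α ↔ α a = a := by
    refine fun α hα a => ⟨?_, fun h => ⟨a, h, rfl⟩⟩
    rintro ⟨b, hb, hba⟩
    obtain ⟨g, rfl⟩ := hπ b a hba
    rw [heq α hα, show α b = b from hb]
  rcases E.eq_empty_or_nonempty with rfl | hne
  · simp
  obtain ⟨α, hα, hmin⟩ := exists_minimalFor_of_wellFoundedLT (· ∈ E) F hne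
  obtain ⟨a₀⟩ := ‹Nonempty A›
  have hfix : ∀ β ∈ E, β (α a₀) = α a₀ := by
    intro β hβ
    have hle : F (α ∘ β) ≤ F α := by
      rintro _ ⟨a, ha, rfl⟩
      refine (mem_F α hα a).2 ?_
      have h := congrFun (hid α hα) (β a)
      simp only [Function.comp_apply, Set.mem_ofPred_eq] at h ha
      rwa [ha] at h
    have hmem := hmin (hmul α hα β hβ) hle ((mem_F α hα _).2 (congrFun (hid α hα) a₀))
    rw [mem_F _ (hmul α hα β hβ), hcomm α hα β hβ] at hmem
    have h := congrFun (hid β hβ) (α (α a₀))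
    simp only [Function.comp_apply] at h hmem
    rwa [hmem] at h
  let f (β : E) : {P : Set Q | π (α a₀) ∈ P} :=
    ⟨F β, (mem_F β β.2 _).2 (hfix β β.2)⟩
  have hf : Function.Injective f := by
    rintro ⟨β, hβ⟩ ⟨γ, hγ⟩ h
    have h' : F β = F γ := congrArg Subtype.val h
    refine Subtype.ext (eq_of_commuting_idempotents_s11 (hid β hβ) (hid γ hγ) (hcomm β hβ γ hγ) ?_)
    intro a
    rw [← mem_F β hβ, ← mem_F γ hγ, h']
  have : Finite E := Finite.of_injective f hf
  exact ⟨Set.toFinite E, (Nat.card_le_card_of_injective f hf).trans_eq (card_setOf_mem _)⟩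

/-- For a free action with `n` orbits and orbit map `π`, there is a semilattice of `2 ^ (n - 1)`
equivariant maps. -/
lemma exists_equivariant_semilattice [Finite Q] [Nonempty A]
    (hfree : ∀ g : G, g ≠ 1 → ∀ a : A, g • a ≠ a)
    (hsurj : Function.Surjective π) (hsmul : ∀ (g : G) a, π (g • a) = π a)
    (hπ : ∀ a b, π a = π b → ∃ g : G, g • a = b) :
    ∃ E : Set (A → A),
        (∀ α ∈ E, ∀ g : G, ∀ a : A, α (g • a) = g • α a) ∧
        (∀ α ∈ E, ∀ β ∈ E, α ∘ β ∈ E) ∧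
        (∀ α ∈ E, α ∘ α = α) ∧
        (∀ α ∈ E, ∀ β ∈ E, α ∘ β = β ∘ α) ∧
        E.Finite ∧ Nat.card E = 2 ^ (Nat.card Q - 1) := by
  classical
  choose r hr using hsurj
  choose t ht using fun a => hπ (r (π a)) a (hr _)
  have ht_smul (g : G) (a : A) : t (g • a) = g * t a := by
    by_contra h
    refine hfree ((g * t a)⁻¹ * t (g • a)) (fun h1 => h (inv_mul_eq_one.1 h1).symm) (r (π a)) ?_
    rw [mul_smul, inv_smul_eq_iff, mul_smul, ht a]
    simpa only [hsmul] using ht (g • a)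
  obtain ⟨a₀⟩ := ‹Nonempty A›
  let q₀ := π a₀
  let f (P : Set Q) (a : A) : A := if π a ∈ P then a else t a • r q₀
  have f_comp : ∀ P ∈ {P : Set Q | q₀ ∈ P}, ∀ P', f P ∘ f P' = f (P ∩ P') := by
    intro P hP P'
    funext a
    simp only [Set.mem_ofPred_eq] at hP
    have h0 : f P (t a • r q₀) = t a • r q₀ := if_pos (by rwa [hsmul, hr])
    by_cases h' : π a ∈ P'
    · simp [f, h']
    · simpa [f, h'] using h0
  have f_inj : Set.InjOn f {P | q₀ ∈ P} := by
    have key : ∀ P P' : Set Q, q₀ ∈ P' → f P = f P' → P ⊆ P' := by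
      intro P P' h0 h q hq
      by_contra hq'
      have h1 := congrArg π (congrFun h (r q))
      simp only [f, hr, hq, hq', if_true, if_false, hsmul] at h1
      exact hq' (h1 ▸ h0)
    exact fun P hP P' hP' h => (key P P' hP' h).antisymm (key P' P hP h.symm)
  refine ⟨f '' {P | q₀ ∈ P}, ?_, ?_, ?_, ?_, Set.toFinite _, ?_⟩
  · rintro _ ⟨P, -, rfl⟩ g a
    simp only [f, hsmul, ht_smul, mul_smul]
    split_ifs <;> rfl
  · rintro _ ⟨P, hP, rfl⟩ _ ⟨P', hP', rfl⟩
    exact ⟨P ∩ P', ⟨hP, hP'⟩, (f_comp P hP P').symm⟩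
  · rintro _ ⟨P, hP, rfl⟩
    rw [f_comp P hP, Set.inter_self]
  · rintro _ ⟨P, hP, rfl⟩ _ ⟨P', hP', rfl⟩
    rw [f_comp P hP, f_comp P' hP', Set.inter_comm]
  · rw [Nat.card_image_of_injOn f_inj, card_setOf_mem]

end EquivariantSemilattice

/-- Let G be a group acting freely on a nonempty set A with exactly n orbits,
n finite and n ≥ 1. Let S be the monoid, under composition, of all G-equivariant maps
α : A → A. Then every subsemilattice of S has at most 2^(n-1) elements, and there exists
a subsemilattice of S with exactly 2^(n-1) elements. -/
theorem stmt_11 (G : Type*) [Group G] (A : Type*) [MulAction G A] [Nonempty A]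
    (hfree : ∀ g : G, g ≠ 1 → ∀ a : A, g • a ≠ a)
    (n : ℕ) (hn : 1 ≤ n)
    (horbfin : {B : Set A | ∃ a : A, B = MulAction.orbit G a}.Finite)
    (horb : Nat.card {B : Set A | ∃ a : A, B = MulAction.orbit G a} = n) :
    (∀ E : Set (A → A),
        (∀ α ∈ E, ∀ g : G, ∀ a : A, α (g • a) = g • α a) →
        (∀ α ∈ E, ∀ β ∈ E, α ∘ β ∈ E) →
        (∀ α ∈ E, α ∘ α = α) →
        (∀ α ∈ E, ∀ β ∈ E, α ∘ β = β ∘ α) →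
        E.Finite ∧ Nat.card E ≤ 2 ^ (n - 1)) ∧
    (∃ E : Set (A → A),
        (∀ α ∈ E, ∀ g : G, ∀ a : A, α (g • a) = g • α a) ∧
        (∀ α ∈ E, ∀ β ∈ E, α ∘ β ∈ E) ∧
        (∀ α ∈ E, α ∘ α = α) ∧
        (∀ α ∈ E, ∀ β ∈ E, α ∘ β = β ∘ α) ∧
        E.Finite ∧ Nat.card E = 2 ^ (n - 1)) := by
  subst horb
  have : Finite {B : Set A | ∃ a : A, B = MulAction.orbit G a} := horbfin
  let π (a : A) : {B : Set A | ∃ a : A, B = MulAction.orbit G a} := ⟨MulAction.orbit G a, a, rfl⟩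
  have hπ : ∀ a b, π a = π b → ∃ g : G, g • a = b := fun a b h =>
    MulAction.orbit_eq_iff.1 (congrArg Subtype.val h).symm
  have hsurj : Function.Surjective π := by
    rintro ⟨_, a, rfl⟩
    exact ⟨a, rfl⟩
  have hsmul (g : G) (a : A) : π (g • a) = π a := Subtype.ext (MulAction.orbit_smul g a)
  exact ⟨fun E => card_le_of_equivariant_semilattice hπ,
    exists_equivariant_semilattice hfree hsurj hsmul hπ⟩
end

section
/- Let G be a group acting on a set A, and let A₀ be a nonempty subset of A such that: every fixed point of every nonidentity element of G lies in A₀, and g·a ∈ A₀ for every g ∈ G and a ∈ A₀. Suppose the action of G on A∖A₀ has exactly n orbits, with n finite. Let S be the monoid, under composition, of all maps α : A → A that are G-equivariant (α(g·a) = g·α(a) for all g, a) and fix A₀ pointwise (α(a) = a for all a ∈ A₀). Then every subsemilattice of S has at most 2^n elements, and there exists a subsemilattice of S with exactly 2^n elements. -/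
/-- Commuting idempotent maps with the same fixed points are equal. -/
theorem eq_of_idempotent_of_commute_of_fixed_iff {A : Type*} {α β : A → A}
    (hα : α ∘ α = α) (hβ : β ∘ β = β) (hc : α ∘ β = β ∘ α)
    (h : ∀ a, α a = a ↔ β a = a) : α = β := by
  funext x
  have h₁ : α (β x) = β x := (h _).2 (congrFun hβ x)
  have h₂ : β (α x) = α x := (h _).1 (congrFun hα x)
  rw [← h₂, ← h₁]
  exact (congrFun hc x).symm

/-- If `G` acts freely off a nonempty invariant set `A₀`, there is an equivariant retraction
onto `A₀`. -/
theorem exists_equivariant_retraction {G : Type*} [Group G] {A : Type*} [MulAction G A]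
    {A₀ : Set A} (hne : A₀.Nonempty)
    (hfix : ∀ g : G, g ≠ 1 → ∀ a : A, g • a = a → a ∈ A₀)
    (hinv : ∀ g : G, ∀ a ∈ A₀, g • a ∈ A₀) :
    ∃ φ : A → A, (∀ g : G, ∀ a : A, φ (g • a) = g • φ a) ∧ (∀ a ∈ A₀, φ a = a) ∧
      ∀ a, φ a ∈ A₀ := by
  classical
  obtain ⟨a₀, ha₀⟩ := hne
  let r : A → A := fun a => (Quotient.mk (MulAction.orbitRel G A) a).out
  have hr : ∀ a, ∃ g : G, g • r a = a := fun a => by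
    have : (MulAction.orbitRel G A) (r a) a := Quotient.mk_out (s := MulAction.orbitRel G A) a
    exact (MulAction.orbitRel G A).symm this
  have hrs : ∀ (g : G) a, r (g • a) = r a := fun g a => by
    have : Quotient.mk (MulAction.orbitRel G A) (g • a) = Quotient.mk _ a :=
      Quotient.sound (s := MulAction.orbitRel G A) ⟨g, rfl⟩
    simp only [r, this]
  choose c hcr using hr
  have hmem : ∀ (g : G) a, g • a ∈ A₀ ↔ a ∈ A₀ := fun g a =>
    ⟨fun h => by simpa using hinv g⁻¹ _ h, hinv g a⟩
  refine ⟨fun a => if a ∈ A₀ then a else c a • a₀, fun g a => ?_, fun a ha => if_pos ha,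
    fun a => ?_⟩
  · by_cases ha : a ∈ A₀
    · simp [hmem, ha]
    · have hra : r a ∉ A₀ := fun h => ha (by rw [← hcr a]; exact hinv _ _ h)
      have key : c (g • a) = g * c a := by
        by_contra hcon
        refine hra (hfix ((g * c a)⁻¹ * c (g • a)) ?_ _ ?_)
        · rwa [Ne, inv_mul_eq_one, eq_comm]
        · have h₁ := hcr (g • a)
          rw [hrs] at h₁
          rw [mul_smul, h₁, inv_smul_eq_iff, mul_smul, hcr]
      simp [hmem, ha, key, mul_smul]
  · dsimp only
    split_ifs with h
    · exact h
    · exact hinv _ _ ha₀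


/-- Let G be a group acting on a set A, and A₀ a nonempty subset of A such
that every fixed point of every nonidentity element of G lies in A₀ and g·a ∈ A₀ for all
g ∈ G, a ∈ A₀. Suppose the action of G on A∖A₀ has exactly n orbits, n finite. Let S be
the monoid, under composition, of all G-equivariant maps α : A → A fixing A₀ pointwise.
Then every subsemilattice of S has at most 2^n elements, and there exists a subsemilattice
of S with exactly 2^n elements. -/
theorem stmt_12 (G : Type*) [Group G] (A : Type*) [MulAction G A]
    (A₀ : Set A) (hne : A₀.Nonempty)
    (hfix : ∀ g : G, g ≠ 1 → ∀ a : A, g • a = a → a ∈ A₀)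
    (hinv : ∀ g : G, ∀ a ∈ A₀, g • a ∈ A₀)
    (n : ℕ)
    (horbfin : {B : Set A | ∃ a ∉ A₀, B = MulAction.orbit G a}.Finite)
    (horb : Nat.card {B : Set A | ∃ a ∉ A₀, B = MulAction.orbit G a} = n) :
    (∀ E : Set (A → A),
        (∀ α ∈ E, (∀ g : G, ∀ a : A, α (g • a) = g • α a) ∧ ∀ a ∈ A₀, α a = a) →
        (∀ α ∈ E, ∀ β ∈ E, α ∘ β ∈ E) →
        (∀ α ∈ E, α ∘ α = α) →
        (∀ α ∈ E, ∀ β ∈ E, α ∘ β = β ∘ α) →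
        E.Finite ∧ Nat.card E ≤ 2 ^ n) ∧
    (∃ E : Set (A → A),
        (∀ α ∈ E, (∀ g : G, ∀ a : A, α (g • a) = g • α a) ∧ ∀ a ∈ A₀, α a = a) ∧
        (∀ α ∈ E, ∀ β ∈ E, α ∘ β ∈ E) ∧
        (∀ α ∈ E, α ∘ α = α) ∧
        (∀ α ∈ E, ∀ β ∈ E, α ∘ β = β ∘ α) ∧
        E.Finite ∧ Nat.card E = 2 ^ n) := by
  classical
  set O : Set (Set A) := {B : Set A | ∃ a ∉ A₀, B = MulAction.orbit G a}
  have : Finite O := horbfin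
  have hcard : Nat.card (Set O) = 2 ^ n := by
    have := Fintype.ofFinite O
    rw [Nat.card_eq_fintype_card, Fintype.card_set, ← horb, Nat.card_eq_fintype_card]
  refine ⟨fun E hE _ hid hcomm => ?_, ?_⟩
  · let F : E → Set O := fun α => {B | ∀ a ∈ B.1, α.1 a = a}
    have hF : Function.Injective F := by
      intro α β hαβ
      have fixed_iff : ∀ γ : E, ∀ a (ha : a ∉ A₀),
          γ.1 a = a ↔ (⟨MulAction.orbit G a, a, ha, rfl⟩ : O) ∈ F γ := by
        intro γ a ha
        constructor
        · rintro h _ ⟨g, rfl⟩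
          exact ((hE _ γ.2).1 g a).trans (congrArg _ h)
        · exact fun h => h a (MulAction.mem_orbit_self a)
      refine Subtype.ext (eq_of_idempotent_of_commute_of_fixed_iff (hid _ α.2) (hid _ β.2)
        (hcomm _ α.2 _ β.2) fun a => ?_)
      by_cases ha : a ∈ A₀
      · simp only [(hE _ α.2).2 a ha, (hE _ β.2).2 a ha]
      · rw [fixed_iff α a ha, fixed_iff β a ha, hαβ]
    exact ⟨Finite.of_injective F hF, hcard ▸ Nat.card_le_card_of_injective F hF⟩
  · obtain ⟨φ, hφ, hφ₀, hφm⟩ := exists_equivariant_retraction hne hfix hinv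
    let f : Set O → A → A := fun T a =>
      if MulAction.orbit G a ∈ Subtype.val '' T then a else φ a
    have hfA : ∀ T, ∀ a ∈ A₀, f T a = a := fun T a ha => by simp only [f, hφ₀ a ha, ite_self]
    have hfφ : ∀ T a, f T (φ a) = φ a := fun T a => hfA T _ (hφm a)
    have hcomp : ∀ T U, f T ∘ f U = f (T ∩ U) := by
      intro T U
      funext a
      have hi : MulAction.orbit G a ∈ Subtype.val '' (T ∩ U) ↔
          MulAction.orbit G a ∈ Subtype.val '' T ∧ MulAction.orbit G a ∈ Subtype.val '' U := by
        rw [Set.image_inter Subtype.val_injective, Set.mem_inter_iff]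
      by_cases hU : MulAction.orbit G a ∈ Subtype.val '' U
      · have h₁ : f U a = a := if_pos hU
        rw [Function.comp_apply, h₁]
        simp only [f, hi, hU, and_true]
      · have h₁ : f U a = φ a := if_neg hU
        rw [Function.comp_apply, h₁, hfφ]
        simp only [f, hi, hU, and_false, if_false]
    have hinj : Function.Injective f := by
      have mem_iff : ∀ T : Set O, ∀ a (ha : a ∉ A₀),
          (⟨MulAction.orbit G a, a, ha, rfl⟩ : O) ∈ T ↔ f T a = a := by
        intro T a ha
        constructor
        · exact fun h => if_pos ⟨_, h, rfl⟩
        · intro h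
          by_contra hn
          have h₁ : f T a = φ a := if_neg <| by
            rintro ⟨B, hB, hBa⟩
            exact hn (by convert hB; exact hBa.symm)
          exact ha (by rw [← h, h₁]; exact hφm a)
      intro T U hTU
      ext ⟨_, a, ha, rfl⟩
      rw [mem_iff T a ha, mem_iff U a ha, hTU]
    refine ⟨Set.range f, ?_, ?_, ?_, ?_, Set.finite_range f, ?_⟩
    · rintro _ ⟨T, rfl⟩
      refine ⟨fun g a => ?_, hfA T⟩
      simp only [f, MulAction.orbit_smul, hφ]
      split_ifs <;> rfl
    · rintro _ ⟨T, rfl⟩ _ ⟨U, rfl⟩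
      exact ⟨T ∩ U, (hcomp T U).symm⟩
    · rintro _ ⟨T, rfl⟩
      rw [hcomp, Set.inter_self]
    · rintro _ ⟨T, rfl⟩ _ ⟨U, rfl⟩
      rw [hcomp, hcomp, Set.inter_comm]
    · rw [← hcard]
      exact (Nat.card_congr (Equiv.ofInjective f hinj)).symm
end

section
/- Let K be a field, m a natural number, and let 𝓔 be a set of m × m matrices over K such that any two matrices in 𝓔 commute and every matrix in 𝓔 is diagonalizable (similar to a diagonal matrix). Then there exists an invertible m × m matrix P over K such that P⁻¹MP is a diagonal matrix for every M ∈ 𝓔. -/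
namespace Module.End
variable {ι K V : Type*} [Field K] [AddCommGroup V] [Module K V]

lemma pow_sub_smul_repr_of_basis_eigenvectors {f : End K V} (b : Basis ι K V) {d : ι → K}
    (hb : ∀ j, f (b j) = d j • b j) (μ : K) (k : ℕ) (v : V) (j : ι) :
    b.repr (((f - μ • 1) ^ k) v) j = (d j - μ) ^ k * b.repr v j := by
  induction k generalizing v with
  | zero => simp
  | succ k ih =>
    have h1 : b.coord j ∘ₗ (f - μ • 1) = (d j - μ) • b.coord j := by
      refine b.ext fun i ↦ ?_
      rcases eq_or_ne i j with rfl | hij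
      · simp [hb]
      · simp [hb, hij]
    have h2 : b.repr ((f - μ • 1) v) j = (d j - μ) * b.repr v j := by
      simpa using LinearMap.congr_fun h1 v
    rw [pow_succ, Module.End.mul_apply, ih, h2]
    ring

lemma maxGenEigenspace_le_eigenspace_of_basis_eigenvectors {f : End K V} (b : Basis ι K V)
    {d : ι → K} (hb : ∀ j, f (b j) = d j • b j) (μ : K) :
    f.maxGenEigenspace μ ≤ f.eigenspace μ := by
  intro v hv
  obtain ⟨k, hk⟩ := (mem_maxGenEigenspace f μ v).mp hv
  have h : (f - μ • 1) v = 0 := by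
    refine b.ext_elem fun j ↦ ?_
    have h1 := pow_sub_smul_repr_of_basis_eigenvectors b hb μ 1 v j
    have h2 := pow_sub_smul_repr_of_basis_eigenvectors b hb μ k v j
    rw [hk] at h2
    rw [pow_one, pow_one] at h1
    rw [h1]
    have h3 : d j - μ = 0 ∨ b.repr v j = 0 :=
      (mul_eq_zero.mp (by simpa only [map_zero, Finsupp.zero_apply] using h2.symm)).imp_left
        eq_zero_of_pow_eq_zero
    rw [mul_eq_zero.mpr h3, map_zero, Finsupp.zero_apply]
  rw [mem_eigenspace_iff]
  simpa [sub_eq_zero] using h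

lemma iSup_maxGenEigenspace_eq_top_of_basis_eigenvectors {f : End K V} (b : Basis ι K V)
    {d : ι → K} (hb : ∀ j, f (b j) = d j • b j) :
    ⨆ μ, f.maxGenEigenspace μ = ⊤ := by
  rw [eq_top_iff, ← b.span_eq, Submodule.span_le]
  rintro _ ⟨j, rfl⟩
  refine Submodule.mem_iSup_of_mem (d j) ((mem_maxGenEigenspace f _ _).mpr ⟨1, ?_⟩)
  simp [hb]

/-- A commuting family of diagonalizable endomorphisms of a finite-dimensional space admits a
basis of simultaneous eigenvectors. -/
lemma span_simultaneous_eigenvectors_eq_top [FiniteDimensional K V] {α : Type*}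
    (f : α → End K V) (hf : ∀ i j, Commute (f i) (f j))
    (h : ∀ i, ∃ (b : Basis ι K V) (d : ι → K), ∀ j, f i (b j) = d j • b j) :
    Submodule.span K {v | ∀ i, ∃ μ : K, f i v = μ • v} = ⊤ := by
  choose b d hb using h
  rw [eq_top_iff, ← iSup_iInf_maxGenEigenspace_eq_top_of_iSup_maxGenEigenspace_eq_top_of_commute f
    (fun i j _ ↦ hf i j) fun i ↦ iSup_maxGenEigenspace_eq_top_of_basis_eigenvectors (b i) (hb i)]
  refine iSup_le fun χ v hv ↦ Submodule.subset_span fun i ↦ ⟨χ i, ?_⟩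
  exact mem_eigenspace_iff.mp <| maxGenEigenspace_le_eigenspace_of_basis_eigenvectors (b i) (hb i) _
    ((Submodule.mem_iInf _).mp hv i)

end Module.End

lemma Matrix.isDiag_conj_iff {n K : Type*} [Fintype n] [DecidableEq n] [Field K]
    {M Q : Matrix n n K} (hQ : IsUnit Q) :
    (Q⁻¹ * M * Q).IsDiag ↔ ∃ d : n → K, ∀ j, M.mulVec (Q.col j) = d j • Q.col j := by
  have hdet := (Matrix.isUnit_iff_isUnit_det Q).mp hQ
  have key (d : n → K) : Q⁻¹ * M * Q = diagonal d ↔ ∀ j, M.mulVec (Q.col j) = d j • Q.col j := by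
    have : Q⁻¹ * M * Q = diagonal d ↔ M * Q = Q * diagonal d := by
      rw [Matrix.mul_assoc]
      constructor
      · intro h
        rw [← h, Matrix.mul_nonsing_inv_cancel_left _ _ hdet]
      · intro h
        rw [h, Matrix.nonsing_inv_mul_cancel_left _ _ hdet]
    rw [this, ← Matrix.ext_iff, forall_comm]
    refine forall_congr' fun j ↦ ?_
    rw [funext_iff]
    refine forall_congr' fun i ↦ ?_
    rw [Matrix.mul_diagonal]
    simp [Matrix.mul_apply, Matrix.mulVec, dotProduct, mul_comm (d j)]
  simp_rw [← key]
  exact ⟨fun h ↦ ⟨_, h.diagonal_diag.symm⟩, fun ⟨d, h⟩ ↦ h ▸ Matrix.isDiag_diagonal d⟩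

/-- Let K be a field, m a natural number, and 𝓔 a set of pairwise commuting
diagonalizable m × m matrices over K. Then there exists an invertible m × m matrix P over K
such that P⁻¹MP is diagonal for every M ∈ 𝓔. -/
theorem stmt_14 (K : Type*) [Field K] (m : ℕ)
    (𝓔 : Set (Matrix (Fin m) (Fin m) K))
    (hcomm : ∀ M ∈ 𝓔, ∀ N ∈ 𝓔, M * N = N * M)
    (hdiag : ∀ M ∈ 𝓔, ∃ Q : Matrix (Fin m) (Fin m) K, IsUnit Q ∧ (Q⁻¹ * M * Q).IsDiag) :
    ∃ P : Matrix (Fin m) (Fin m) K, IsUnit P ∧ ∀ M ∈ 𝓔, (P⁻¹ * M * P).IsDiag := by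
  classical
  have hspan := Module.End.span_simultaneous_eigenvectors_eq_top (ι := Fin m)
    (fun M : 𝓔 ↦ Matrix.toLinAlgEquiv' M.1)
    (fun M N ↦ (show Commute M.1 N.1 from hcomm M.1 M.2 N.1 N.2).map Matrix.toLinAlgEquiv')
    (fun M ↦ by
      obtain ⟨Q, hQ, hd⟩ := hdiag M.1 M.2
      obtain ⟨d, hd⟩ := (Matrix.isDiag_conj_iff hQ).mp hd
      refine ⟨basisOfPiSpaceOfLinearIndependent
        (Matrix.linearIndependent_cols_of_isUnit hQ), d, fun j ↦ ?_⟩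
      simpa using hd j)
  let b := Module.Basis.ofSpan hspan.ge
  have : Fintype _ := FiniteDimensional.fintypeBasisIndex b
  let e := b.indexEquiv (Pi.basisFun K (Fin m))
  let c := b.reindex e
  have hc (j : Fin m) (M : 𝓔) : ∃ μ : K, M.1.mulVec (c j) = μ • c j := by
    have := Module.Basis.ofSpan_subset hspan.ge ⟨e.symm j, rfl⟩ M
    rw [Module.Basis.reindex_apply]
    exact this
  have hP : IsUnit (Matrix.of fun i j ↦ c j i) :=
    Matrix.linearIndependent_cols_iff_isUnit.mp c.linearIndependent
  refine ⟨_, hP, fun M hM ↦ (Matrix.isDiag_conj_iff hP).mpr ?_⟩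
  choose d hd using fun j ↦ hc j ⟨M, hM⟩
  exact ⟨d, hd⟩
end

section
/- Let K be a division ring, V a K-vector space, and A₀ a linear subspace of V such that the quotient space V/A₀ has finite dimension n. Let E be a set of K-linear endomorphisms of V such that every element of E is idempotent, any two elements of E commute, and every element of E fixes A₀ pointwise (ε(a) = a for all a ∈ A₀). Then E is finite and |E| ≤ 2^n. -/
open Module LinearMap in
theorem finrank_range_add_finrank_range_sub_le {K W : Type*} [DivisionRing K] [AddCommGroup W]
    [Module K W] [FiniteDimensional K W] {e φ : End K W} (hφ : φ * φ = φ)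
    (heφ : e * φ = φ) (hφe : φ * e = φ) :
    finrank K (range φ) + finrank K (range (e - φ)) ≤ finrank K (range e) := by
  have hd : Disjoint (range φ) (range (e - φ)) := by
    rw [Submodule.disjoint_def]
    rintro _ ⟨x, rfl⟩ ⟨y, hy⟩
    have h : φ * (e - φ) = 0 := by rw [mul_sub, hφ, hφe, sub_self]
    calc φ x = φ (φ x) := (LinearMap.congr_fun hφ x).symm
      _ = (φ * (e - φ)) y := by rw [← hy]; rfl
      _ = 0 := by rw [h]; rfl
  have hle : range φ ⊔ range (e - φ) ≤ range e := by
    have h₁ : range φ ≤ range e := by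
      rintro _ ⟨x, rfl⟩
      exact ⟨φ x, LinearMap.congr_fun heφ x⟩
    refine sup_le h₁ ?_
    rintro _ ⟨x, rfl⟩
    exact sub_mem (mem_range_self e x) (h₁ (mem_range_self φ x))
  rw [← Submodule.finrank_sup_add_finrank_inf_eq, hd.eq_bot, finrank_bot, add_zero]
  exact Submodule.finrank_mono hle

open Module LinearMap in
theorem encard_commuting_idempotents_le_of_corner {K W : Type*} [DivisionRing K]
    [AddCommGroup W] [Module K W] [FiniteDimensional K W] (n : ℕ) (e : End K W) (he : e * e = e)
    (hn : finrank K (range e) = n) (S : Set (End K W)) (hidem : ∀ φ ∈ S, φ * φ = φ)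
    (hcomm : ∀ φ ∈ S, ∀ ψ ∈ S, φ * ψ = ψ * φ) (hl : ∀ φ ∈ S, e * φ = φ)
    (hr : ∀ φ ∈ S, φ * e = φ) : S.encard ≤ 2 ^ n := by
  induction n using Nat.strong_induction_on generalizing e S with
  | _ n ih =>
  have hpos {f : End K W} (hf : f ≠ 0) : 0 < finrank K (range f) := by
    rw [Nat.pos_iff_ne_zero, Ne, Submodule.finrank_eq_zero, range_eq_bot]
    exact hf
  by_cases hS : S ⊆ {0, e}
  · by_cases he0 : e = 0
    · subst he0
      calc S.encard ≤ ({0, 0} : Set (End K W)).encard := Set.encard_le_encard hS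
        _ = 1 := by simp
        _ ≤ 2 ^ n := one_le_pow₀ (by norm_num)
    · calc S.encard ≤ ({0, e} : Set (End K W)).encard := Set.encard_le_encard hS
        _ = 2 := Set.encard_pair (Ne.symm he0)
        _ ≤ 2 ^ n := le_self_pow₀ (by norm_num) (hn ▸ (hpos he0).ne')
  obtain ⟨φ, hφS, hφ⟩ := Set.not_subset.1 hS
  simp only [Set.mem_insert_iff, Set.mem_singleton_iff, not_or] at hφ
  have hφφ := hidem φ hφS
  have hrank := finrank_range_add_finrank_range_sub_le hφφ (hl φ hφS) (hr φ hφS)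
  have h₁ := hpos hφ.1
  have h₂ := hpos (sub_ne_zero.2 (Ne.symm hφ.2))
  have key (f : End K W) (hf : f * f = f) (hlt : finrank K (range f) < n)
      (hfc : ∀ ψ ∈ S, f * ψ = ψ * f) :
      ((f * ·) '' S).encard ≤ 2 ^ finrank K (range f) := by
    have hmul {a b : End K W} (ha : a ∈ S) : f * a * (f * b) = f * (a * b) := by
      rw [mul_assoc, ← mul_assoc a, ← hfc a ha, mul_assoc, ← mul_assoc, hf]
    refine ih _ hlt f hf rfl _ ?_ ?_ ?_ ?_
    · rintro _ ⟨a, ha, rfl⟩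
      simp only [hmul ha, hidem a ha]
    · rintro _ ⟨a, ha, rfl⟩ _ ⟨b, hb, rfl⟩
      simp only [hmul ha, hmul hb, hcomm a ha b hb]
    · rintro _ ⟨a, ha, rfl⟩
      simp only [← mul_assoc, hf]
    · rintro _ ⟨a, ha, rfl⟩
      simp only [mul_assoc, ← hfc a ha]
      rw [← mul_assoc, hf]
  have k₁ := key φ hφφ (by omega) (hcomm φ hφS)
  have k₂ := key (e - φ) (by rw [sub_mul, mul_sub, mul_sub, he, hφφ, hl φ hφS, hr φ hφS]; abel)
    (by omega) fun ψ hψ => by rw [sub_mul, mul_sub, hl ψ hψ, hr ψ hψ, hcomm φ hφS ψ hψ]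
  have hinj : S.InjOn fun ψ => (φ * ψ, (e - φ) * ψ) := by
    intro a ha b hb hab
    obtain ⟨h, h'⟩ := Prod.mk.inj hab
    rw [sub_mul, sub_mul, hl a ha, hl b hb, h] at h'
    exact sub_left_injective h'
  calc S.encard = ((fun ψ => (φ * ψ, (e - φ) * ψ)) '' S).encard := hinj.encard_image.symm
    _ ≤ (((φ * ·) '' S) ×ˢ (((e - φ) * ·) '' S)).encard := Set.encard_le_encard <| by
        rintro _ ⟨a, ha, rfl⟩
        exact ⟨⟨a, ha, rfl⟩, ⟨a, ha, rfl⟩⟩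
    _ = ((φ * ·) '' S).encard * (((e - φ) * ·) '' S).encard := Set.encard_prod
    _ ≤ 2 ^ finrank K (range φ) * 2 ^ finrank K (range (e - φ)) := mul_le_mul' k₁ k₂
    _ = 2 ^ (finrank K (range φ) + finrank K (range (e - φ))) := (pow_add _ _ _).symm
    _ ≤ 2 ^ n := pow_le_pow_right₀ (by norm_num) (hn ▸ hrank)

/-- A set of pairwise commuting idempotent endomorphisms of an `n`-dimensional space has at most
`2 ^ n` elements. -/
theorem encard_commuting_idempotents_le {K W : Type*} [DivisionRing K] [AddCommGroup W]
    [Module K W] [FiniteDimensional K W] (S : Set (Module.End K W)) (hidem : ∀ φ ∈ S, φ * φ = φ)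
    (hcomm : ∀ φ ∈ S, ∀ ψ ∈ S, φ * ψ = ψ * φ) : S.encard ≤ 2 ^ Module.finrank K W :=
  encard_commuting_idempotents_le_of_corner _ 1 (one_mul 1)
    (by rw [Module.End.one_eq_id, LinearMap.range_id, finrank_top]) S hidem hcomm
    (fun _ _ => one_mul _) fun _ _ => mul_one _

/-- Let K be a division ring, V a K-vector space, and A₀ a linear subspace
of V such that V/A₀ has finite dimension n. Let E be a set of pairwise commuting idempotent
K-linear endomorphisms of V all fixing A₀ pointwise. Then E is finite and |E| ≤ 2^n. -/
theorem stmt_15 (K : Type*) [DivisionRing K] (V : Type*) [AddCommGroup V] [Module K V]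
    (A₀ : Submodule K V) [FiniteDimensional K (V ⧸ A₀)]
    (n : ℕ) (hn : Module.finrank K (V ⧸ A₀) = n)
    (E : Set (Module.End K V))
    (hidem : ∀ ε ∈ E, ε * ε = ε)
    (hcomm : ∀ ε₁ ∈ E, ∀ ε₂ ∈ E, ε₁ * ε₂ = ε₂ * ε₁)
    (hfix : ∀ ε ∈ E, ∀ a ∈ A₀, ε a = a) :
    E.Finite ∧ Nat.card E ≤ 2 ^ n := by
  have hle : ∀ ε : E, A₀ ≤ A₀.comap ε.1 := fun ε a ha => by
    rw [Submodule.mem_comap, hfix ε ε.2 a ha]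
    exact ha
  let q : E → Module.End K (V ⧸ A₀) := fun ε => A₀.mapQ A₀ ε.1 (hle ε)
  have hq_inj : Function.Injective q := by
    have hdiff {α β : E} (h : q α = q β) (x : V) : α.1 x - β.1 x ∈ A₀ :=
      (Submodule.Quotient.eq A₀).1 (LinearMap.congr_fun h (A₀.mkQ x))
    have habs {α β : E} (h : q α = q β) (x : V) : α.1 x - β.1 x = α.1 x - α.1 (β.1 x) := by
      have hx := hfix α α.2 _ (hdiff h x)
      have hα : α.1 (α.1 x) = α.1 x := LinearMap.congr_fun (hidem α α.2) x
      rw [← hx, map_sub, hα]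
    intro α β h
    ext x
    have h₁ := habs h x
    have h₂ := habs h.symm x
    have hc : α.1 (β.1 x) = β.1 (α.1 x) := LinearMap.congr_fun (hcomm α α.2 β β.2) x
    exact ((sub_right_injective h₁).trans (hc.trans (sub_right_injective h₂).symm)).symm
  have hcard : E.encard ≤ 2 ^ n := by
    rw [← hn, Set.encard, ← Set.encard_univ, ← hq_inj.encard_image, Set.image_univ]
    refine encard_commuting_idempotents_le _ ?_ ?_
    · rintro _ ⟨α, rfl⟩
      ext x
      exact congrArg A₀.mkQ (LinearMap.congr_fun (hidem α α.2) x)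
    · rintro _ ⟨α, rfl⟩ _ ⟨β, rfl⟩
      ext x
      exact congrArg A₀.mkQ (LinearMap.congr_fun (hcomm α α.2 β β.2) x)
  have hcard' : E.encard ≤ ((2 ^ n : ℕ) : ℕ∞) := by exact_mod_cast hcard
  have hfin : E.Finite := Set.finite_of_encard_le_coe hcard'
  refine ⟨hfin, ?_⟩
  rw [Nat.card_coe_set_eq]
  rw [← hfin.cast_ncard_eq] at hcard'
  exact_mod_cast hcard'
end

section
/- Let K be a division ring, V a K-vector space, and A₀ a linear subspace of V such that the quotient space V/A₀ has finite dimension m. Consider the monoid, under composition, of all affine endomorphisms of V whose linear part fixes A₀ pointwise (these are exactly the endomorphisms of the affine independence algebra determined by (V, A₀, K), an independence algebra of dimension n = m + 1). Then every subsemilattice of this monoid has at most 2^m = 2^(n-1) elements, and there exists a subsemilattice with exactly 2^m elements. -/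
/-- A finite set of pairwise commuting idempotent endomorphisms of an `m`-dimensional vector space
has at most `2 ^ m` elements. -/
theorem card_le_two_pow_finrank_of_commute_of_idempotent {K : Type*} [DivisionRing K]
    (n : ℕ) : ∀ {W : Type*} [AddCommGroup W] [Module K W] [FiniteDimensional K W]
    (_ : Module.finrank K W = n) (S : Finset (Module.End K W))
    (_ : ∀ f ∈ S, ∀ x, f (f x) = f x) (_ : ∀ f ∈ S, ∀ g ∈ S, ∀ x, f (g x) = g (f x)),
    S.card ≤ 2 ^ n := by
  classical
  induction n using Nat.strong_induction_on with
  | _ n ih =>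
  intro W _ _ _ hn S hid hcomm
  by_cases htriv : ∀ e ∈ S, e = 0 ∨ e = 1
  · rcases Nat.eq_zero_or_pos n with rfl | hpos
    · have : Subsingleton W := Module.finrank_zero_iff.mp hn
      have : Subsingleton (Module.End K W) := ⟨fun f g => LinearMap.ext fun x =>
        Subsingleton.elim _ _⟩
      simpa using Finset.card_le_one_of_subsingleton S
    · calc S.card ≤ ({0, 1} : Finset (Module.End K W)).card :=
            Finset.card_le_card fun e he => by simpa using htriv e he
        _ ≤ 2 := Finset.card_le_two
        _ = 2 ^ 1 := rfl
        _ ≤ 2 ^ n := Nat.pow_le_pow_right two_pos hpos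
  · push Not at htriv
    obtain ⟨e, he, he0, he1⟩ := htriv
    have hrange : ∀ f ∈ S, ∀ x ∈ LinearMap.range e, f x ∈ LinearMap.range e := by
      rintro f hf _ ⟨x, rfl⟩
      exact ⟨f x, hcomm e he f hf x⟩
    have hker : ∀ f ∈ S, ∀ x ∈ LinearMap.ker e, f x ∈ LinearMap.ker e := by
      intro f hf x hx
      rw [LinearMap.mem_ker] at hx ⊢
      rw [hcomm e he f hf, hx, map_zero]
    have key : ∀ p : Submodule K W, Module.finrank K p < n →
        (hp : ∀ f ∈ S, ∀ x ∈ p, f x ∈ p) →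
        (S.attach.image fun f => (f.1.restrict (hp f.1 f.2) : Module.End K p)).card ≤
          2 ^ Module.finrank K p := by
      intro p hlt hp
      refine ih _ hlt rfl _ ?_ ?_
      · simp only [Finset.mem_image, Finset.mem_attach, true_and]
        rintro _ ⟨f, rfl⟩ x
        exact Subtype.ext (hid f.1 f.2 x)
      · simp only [Finset.mem_image, Finset.mem_attach, true_and]
        rintro _ ⟨f, rfl⟩ _ ⟨g, rfl⟩ x
        exact Subtype.ext (hcomm f.1 f.2 g.1 g.2 x)
    have hsum := LinearMap.finrank_range_add_finrank_ker e
    have hr : 0 < Module.finrank K (LinearMap.range e) := by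
      rw [Nat.pos_iff_ne_zero, ne_eq, Submodule.finrank_eq_zero, LinearMap.range_eq_bot]
      exact he0
    have hk : 0 < Module.finrank K (LinearMap.ker e) := by
      rw [Nat.pos_iff_ne_zero, ne_eq, Submodule.finrank_eq_zero]
      intro hbot
      refine he1 (LinearMap.ext fun x => ?_)
      exact LinearMap.ker_eq_bot.mp hbot (hid e he x)
    have h1 := key _ (by lia) hrange
    have h2 := key _ (by lia) hker
    rw [← hn, ← hsum, pow_add]
    refine le_trans ?_ (Nat.mul_le_mul h1 h2)
    rw [← Finset.card_product, ← Finset.card_attach]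
    refine Finset.card_le_card_of_injOn
      (fun f => (f.1.restrict (hrange f.1 f.2), f.1.restrict (hker f.1 f.2))) ?_ ?_
    · intro f _
      simp only [Finset.coe_product, Set.mem_prod, Finset.mem_coe]
      exact ⟨Finset.mem_image_of_mem _ (Finset.mem_attach _ _),
        Finset.mem_image_of_mem _ (Finset.mem_attach _ _)⟩
    · intro f _ g _ hfg
      obtain ⟨hfg₁, hfg₂⟩ := Prod.mk.inj hfg
      refine Subtype.ext (LinearMap.ext fun x => ?_)
      have hx₁ : f.1 (e x) = g.1 (e x) :=
        congrArg Subtype.val (LinearMap.congr_fun hfg₁ ⟨e x, x, rfl⟩)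
      have hx₂ : f.1 (x - e x) = g.1 (x - e x) :=
        congrArg Subtype.val (LinearMap.congr_fun hfg₂ ⟨x - e x, by simp [hid e he]⟩)
      rw [← sub_add_cancel x (e x), map_add, map_add, hx₁, hx₂]

/-- Finitely many pairwise commuting idempotent self-maps of a nonempty type have a common
fixed point. -/
theorem exists_common_fixed_point_of_commute_of_idempotent {X : Type*} [Nonempty X]
    (t : Finset (X → X)) (hid : ∀ f ∈ t, f ∘ f = f)
    (hcomm : ∀ f ∈ t, ∀ g ∈ t, f ∘ g = g ∘ f) : ∃ p, ∀ f ∈ t, f p = p := by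
  classical
  induction t using Finset.induction_on with
  | empty => exact ⟨Classical.arbitrary X, by simp⟩
  | insert f t _ ih =>
    obtain ⟨p, hp⟩ := ih (fun g hg => hid g (Finset.mem_insert_of_mem hg)) fun g hg h hh =>
      hcomm g (Finset.mem_insert_of_mem hg) h (Finset.mem_insert_of_mem hh)
    refine ⟨f p, fun g hg => ?_⟩
    rcases Finset.mem_insert.mp hg with rfl | hgt
    · exact congrFun (hid g hg) p
    · have := congrFun (hcomm g hg f (Finset.mem_insert_self f t)) p
      rwa [Function.comp_apply, Function.comp_apply, hp g hgt] at this

/-- A finite set of pairwise commuting idempotent affine endomorphisms of `V` whose linear parts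
fix `A₀` pointwise has at most `2 ^ dim (V ⧸ A₀)` elements. -/
theorem card_le_two_pow_finrank_quotient_of_affine {K V : Type*} [DivisionRing K]
    [AddCommGroup V] [Module K V] (A₀ : Submodule K V) [FiniteDimensional K (V ⧸ A₀)]
    (t : Finset (V → V))
    (haff : ∀ ε ∈ t, ∃ α : V →ₗ[K] V, ∃ c : V,
      (∀ a ∈ A₀, α a = a) ∧ ε = fun x : V => α x + c)
    (hid : ∀ ε ∈ t, ε ∘ ε = ε) (hcomm : ∀ ε₁ ∈ t, ∀ ε₂ ∈ t, ε₁ ∘ ε₂ = ε₂ ∘ ε₁) :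
    t.card ≤ 2 ^ Module.finrank K (V ⧸ A₀) := by
  classical
  obtain ⟨p, hp⟩ := exists_common_fixed_point_of_commute_of_idempotent t hid hcomm
  choose! α c hfix hα using haff
  have hval : ∀ ε ∈ t, ∀ x, ε (p + x) = p + α ε x := by
    intro ε hε x
    have hpε : α ε p + c ε = p := (congrFun (hα ε hε) p).symm.trans (hp ε hε)
    have hx : ε (p + x) = α ε (p + x) + c ε := congrFun (hα ε hε) (p + x)
    rw [hx, map_add, add_right_comm, hpε]
  have hαid : ∀ ε ∈ t, ∀ x, α ε (α ε x) = α ε x := by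
    intro ε hε x
    have := congrFun (hid ε hε) (p + x)
    simpa [hval ε hε] using this
  have hαcomm : ∀ ε ∈ t, ∀ δ ∈ t, ∀ x, α ε (α δ x) = α δ (α ε x) := by
    intro ε hε δ hδ x
    have := congrFun (hcomm ε hε δ hδ) (p + x)
    simpa [hval ε hε, hval δ hδ] using this
  have hinv : ∀ ε ∈ t, A₀ ≤ A₀.comap (α ε) := by
    intro ε hε a ha
    rw [Submodule.mem_comap, hfix ε hε a ha]
    exact ha
  let q : {ε // ε ∈ t} → Module.End K (V ⧸ A₀) := fun ε => A₀.mapQ A₀ (α ε.1) (hinv ε.1 ε.2)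
  have hq : Function.Injective q := by
    rintro ⟨ε, hε⟩ ⟨δ, hδ⟩ h
    have hmem : ∀ x, α ε x - α δ x ∈ A₀ := fun x =>
      (Submodule.Quotient.eq A₀).mp (LinearMap.congr_fun h (Submodule.Quotient.mk x))
    have heq : ∀ x, α ε x = α δ x := by
      intro x
      have h1 := hfix ε hε _ (hmem x)
      have h2 := hfix δ hδ _ (hmem x)
      rw [map_sub, hαid ε hε] at h1
      rw [map_sub, hαid δ hδ] at h2
      rw [← sub_right_injective h1, hαcomm ε hε δ hδ]
      exact (sub_left_injective h2).symm
    refine Subtype.ext (funext fun x => ?_)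
    have h1 := hval ε hε (x - p)
    have h2 := hval δ hδ (x - p)
    rw [heq, ← h2] at h1
    simpa using h1
  rw [← Finset.card_attach, ← Finset.card_image_of_injective _ hq]
  refine card_le_two_pow_finrank_of_commute_of_idempotent _ rfl _ ?_ ?_
  · simp only [Finset.mem_image, Finset.mem_attach, true_and]
    rintro _ ⟨ε, rfl⟩ x
    obtain ⟨x, rfl⟩ := Submodule.Quotient.mk_surjective _ x
    exact congrArg Submodule.Quotient.mk (hαid ε.1 ε.2 x)
  · simp only [Finset.mem_image, Finset.mem_attach, true_and]
    rintro _ ⟨ε, rfl⟩ _ ⟨δ, rfl⟩ x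
    obtain ⟨x, rfl⟩ := Submodule.Quotient.mk_surjective _ x
    exact congrArg Submodule.Quotient.mk (hαcomm ε.1 ε.2 δ.1 δ.2 x)

/-- There are endomorphisms of `V` fixing `A₀` pointwise, indexed injectively by the sets of
indices of a basis of `V ⧸ A₀`, which compose according to the union of these sets. -/
theorem exists_injective_finset_to_end_fixing {K V : Type*} [DivisionRing K]
    [AddCommGroup V] [Module K V] (A₀ : Submodule K V) {ι : Type*} [DecidableEq ι]
    (b : Module.Basis ι K (V ⧸ A₀)) :
    ∃ F : Finset ι → Module.End K V, Function.Injective F ∧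
      (∀ I J x, F I (F J x) = F (I ∪ J) x) ∧ ∀ I, ∀ a ∈ A₀, F I a = a := by
  obtain ⟨s, hs⟩ := A₀.mkQ.exists_rightInverse_of_surjective A₀.range_mkQ
  have hs' : ∀ y, A₀.mkQ (s y) = y := fun y => LinearMap.congr_fun hs y
  let P : Finset ι → Module.End K (V ⧸ A₀) := fun I =>
    b.constr ℕ fun i => if i ∈ I then 0 else b i
  have hPb : ∀ I i, P I (b i) = if i ∈ I then 0 else b i := fun I i => b.constr_basis ℕ _ i
  have hP : ∀ I J y, P I (P J y) = P (I ∪ J) y := by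
    intro I J y
    refine LinearMap.congr_fun (f := P I ∘ₗ P J) (b.ext fun i => ?_) y
    rw [LinearMap.comp_apply, hPb J, hPb (I ∪ J)]
    by_cases hJ : i ∈ J <;> by_cases hI : i ∈ I <;> simp [hI, hJ, hPb]
  let F : Finset ι → Module.End K V := fun I =>
    LinearMap.id - s ∘ₗ A₀.mkQ + s ∘ₗ P I ∘ₗ A₀.mkQ
  have hF : ∀ I x, F I x = x - s (A₀.mkQ x) + s (P I (A₀.mkQ x)) := fun I x => rfl
  have hmkF : ∀ I x, A₀.mkQ (F I x) = P I (A₀.mkQ x) := by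
    intro I x
    rw [hF, map_add, map_sub, hs', hs', sub_self, zero_add]
  refine ⟨F, ?_, ?_, ?_⟩
  · intro I J h
    ext i
    have hi : P I (b i) = P J (b i) := by rw [← hs' (b i), ← hmkF, ← hmkF, h]
    have hb : b i ≠ 0 := b.ne_zero i
    rw [hPb, hPb] at hi
    by_cases hJ : i ∈ J <;> by_cases hI : i ∈ I <;> simp_all
  · intro I J x
    rw [hF I, hmkF, hP, hF J, hF (I ∪ J), add_sub_cancel_right]
  · intro I a ha
    have : A₀.mkQ a = 0 := (Submodule.Quotient.mk_eq_zero A₀).mpr ha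
    rw [hF, this, map_zero, map_zero, map_zero, sub_zero, add_zero]


/-- Let K be a division ring, V a K-vector space, and A₀ a linear subspace
of V such that V/A₀ has finite dimension m. Consider the monoid, under composition, of all
affine endomorphisms of V whose linear part fixes A₀ pointwise (the endomorphisms of the
affine independence algebra determined by (V, A₀, K), of dimension n = m + 1). Then every
subsemilattice of this monoid has at most 2^m = 2^(n-1) elements, and there exists a
subsemilattice with exactly 2^m elements. -/
theorem stmt_19 (K : Type*) [DivisionRing K] (V : Type*) [AddCommGroup V] [Module K V]
    (A₀ : Submodule K V) [FiniteDimensional K (V ⧸ A₀)]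
    (m : ℕ) (hm : Module.finrank K (V ⧸ A₀) = m) :
    (∀ E : Set (V → V),
        (∀ ε ∈ E, ∃ α : V →ₗ[K] V, ∃ c : V,
          (∀ a ∈ A₀, α a = a) ∧ ε = fun x : V => α x + c) →
        (∀ ε₁ ∈ E, ∀ ε₂ ∈ E, ε₁ ∘ ε₂ ∈ E) →
        (∀ ε ∈ E, ε ∘ ε = ε) →
        (∀ ε₁ ∈ E, ∀ ε₂ ∈ E, ε₁ ∘ ε₂ = ε₂ ∘ ε₁) →
        E.Finite ∧ Nat.card E ≤ 2 ^ m) ∧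
    (∃ E : Set (V → V),
        (∀ ε ∈ E, ∃ α : V →ₗ[K] V, ∃ c : V,
          (∀ a ∈ A₀, α a = a) ∧ ε = fun x : V => α x + c) ∧
        (∀ ε₁ ∈ E, ∀ ε₂ ∈ E, ε₁ ∘ ε₂ ∈ E) ∧
        (∀ ε ∈ E, ε ∘ ε = ε) ∧
        (∀ ε₁ ∈ E, ∀ ε₂ ∈ E, ε₁ ∘ ε₂ = ε₂ ∘ ε₁) ∧
        E.Finite ∧ Nat.card E = 2 ^ m) := by
  classical
  subst hm
  refine ⟨fun E haff _ hid hcomm => ?_, ?_⟩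
  · have hbound : ∀ t : Finset (V → V), (t : Set (V → V)) ⊆ E →
        t.card ≤ 2 ^ Module.finrank K (V ⧸ A₀) := fun t ht =>
      card_le_two_pow_finrank_quotient_of_affine A₀ t (fun ε hε => haff ε (ht hε))
        (fun ε hε => hid ε (ht hε)) fun ε hε δ hδ => hcomm ε (ht hε) δ (ht hδ)
    have hfin : E.Finite := by
      by_contra hinf
      obtain ⟨t, ht, hcard⟩ :=
        Set.Infinite.exists_subset_card_eq hinf (2 ^ Module.finrank K (V ⧸ A₀) + 1)
      have := hbound t ht
      lia
    refine ⟨hfin, ?_⟩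
    rw [Nat.card_coe_set_eq, Set.ncard_eq_toFinset_card E hfin]
    exact hbound _ hfin.coe_toFinset.subset
  · obtain ⟨F, hinj, hunion, hfix⟩ :=
      exists_injective_finset_to_end_fixing A₀ (Module.finBasis K (V ⧸ A₀))
    have hinj' : Function.Injective fun I => (F I : V → V) := fun I J h =>
      hinj (DFunLike.coe_injective h)
    refine ⟨Set.range fun I => (F I : V → V), ?_, ?_, ?_, ?_, Set.finite_range _, ?_⟩
    · rintro _ ⟨I, rfl⟩
      exact ⟨F I, 0, hfix I, by simp⟩
    · rintro _ ⟨I, rfl⟩ _ ⟨J, rfl⟩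
      exact ⟨I ∪ J, funext fun x => (hunion I J x).symm⟩
    · rintro _ ⟨I, rfl⟩
      exact funext fun x => by simp [hunion]
    · rintro _ ⟨I, rfl⟩ _ ⟨J, rfl⟩
      exact funext fun x => by simp [hunion, Finset.union_comm]
    · rw [Nat.card_range_of_injective hinj']
      simp
end
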